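/- Let d, n, m be positive integers with 0 < d < n ≤ m. Suppose that the rational number D = Π_{i=0}^{n−d} ((m+i)! · i!) / ((d−1+i)! · (m−d+1+i)!) is an odd integer. If C is an ℝ-linear subspace of the space of m×n real matrices such that every nonzero matrix in C has rank at least d, then dim_ℝ C ≤ (m − d + 1)·(n − d + 1). -/

import Mathlib

namespace OddBezout

/-- A real polynomial of odd degree has a real root. -/
theorem real_odd_root (f : Polynomial ℝ) (hf : Odd f.natDegree) : ∃ x, f.IsRoot x := by
  wlog hl : 0 < f.leadingCoeff generalizing f with H
  · have hne : f ≠ 0 := by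
      rintro rfl
      simp at hf
    have h0 : f.leadingCoeff ≠ 0 := Polynomial.leadingCoeff_ne_zero.mpr hne
    have hlt : f.leadingCoeff < 0 := lt_of_le_of_ne (not_lt.mp hl) h0
    obtain ⟨x, hx⟩ := H (-f) (by simpa using hf) (by simpa using hlt)
    exact ⟨x, by simpa [Polynomial.IsRoot] using hx⟩
  have hdeg : 0 < f.degree := Polynomial.natDegree_pos_iff_degree_pos.mp hf.pos
  have h1 : Filter.Tendsto (fun x => f.eval x) Filter.atTop Filter.atTop :=
    Polynomial.tendsto_atTop_of_leadingCoeff_nonneg f hdeg hl.le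
  have hdeg2 : (f.comp (-Polynomial.X)).natDegree = f.natDegree := by
    rw [Polynomial.natDegree_comp]; simp
  have hl2 : (f.comp (-Polynomial.X)).leadingCoeff = - f.leadingCoeff := by
    rw [Polynomial.leadingCoeff_comp (by simp)]
    simp [hf.neg_one_pow]
  have h2 : Filter.Tendsto (fun x => (f.comp (-Polynomial.X)).eval x) Filter.atTop Filter.atBot :=
    Polynomial.tendsto_atBot_of_leadingCoeff_nonpos _
      (Polynomial.natDegree_pos_iff_degree_pos.mp (by rw [hdeg2]; exact hf.pos))
      (by rw [hl2]; linarith)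
  obtain ⟨a, ha⟩ := (h1.eventually (Filter.eventually_ge_atTop 0)).exists
  obtain ⟨b, hb⟩ := (h2.eventually (Filter.eventually_le_atBot 0)).exists
  have hb' : f.eval (-b) ≤ 0 := by simpa using hb
  have := mem_range_of_exists_le_of_exists_ge f.continuous ⟨-b, hb'⟩ ⟨a, ha⟩
  obtain ⟨x, hx⟩ := this
  exact ⟨x, hx⟩

theorem odd_eigen {V : Type*} [AddCommGroup V] [Module ℝ V] [FiniteDimensional ℝ V]
    (hV : Odd (Module.finrank ℝ V)) (T : Module.End ℝ V) : ∃ μ : ℝ, T.HasEigenvalue μ := by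
  obtain ⟨x, hx⟩ := real_odd_root T.charpoly (by rw [LinearMap.charpoly_natDegree]; exact hV)
  exact ⟨x, by rwa [Module.End.hasEigenvalue_iff_isRoot_charpoly]⟩

/-- Commuting operators on an odd-dimensional real space have a common eigenvector. -/
theorem common_eigen {κ : Type*} (n : ℕ) : ∀ {V : Type} [AddCommGroup V] [Module ℝ V]
    [FiniteDimensional ℝ V] (_ : Module.finrank ℝ V = n) (_ : Odd n) (T : κ → Module.End ℝ V)
    (_ : ∀ i j, Commute (T i) (T j)), ∃ v : V, v ≠ 0 ∧ ∀ i, ∃ μ : ℝ, T i v = μ • v := by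
  induction n using Nat.strong_induction_on with
  | _ n ih =>
  intro V _ _ _ hn hodd T hT
  by_cases hsc : ∀ i, ∃ μ : ℝ, ∀ v, T i v = μ • v
  · have : Nontrivial V := Module.nontrivial_of_finrank_pos (R := ℝ) (by rw [hn]; exact hodd.pos)
    obtain ⟨v, hv⟩ := exists_ne (0 : V)
    exact ⟨v, hv, fun i => (hsc i).imp fun μ h => h v⟩
  push Not at hsc
  obtain ⟨i, hi⟩ := hsc
  obtain ⟨μ, hμ⟩ := odd_eigen (by rw [hn]; exact hodd) (T i)
  let S : Module.End ℝ V := T i - algebraMap ℝ _ μ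
  have hS : ∀ j, Commute (T j) S := fun j =>
    (hT j i).sub_right (Algebra.commutes μ (T j)).symm
  have hrn := LinearMap.finrank_range_add_finrank_ker S
  have hker : 0 < Module.finrank ℝ (LinearMap.ker S) := by
    have h1 := hμ
    rw [Module.End.hasEigenvalue_iff, Module.End.eigenspace_def] at h1
    exact Module.finrank_pos_iff.mpr (Submodule.nontrivial_iff_ne_bot.mpr h1)
  have hran : 0 < Module.finrank ℝ (LinearMap.range S) := by
    refine Module.finrank_pos_iff.mpr (Submodule.nontrivial_iff_ne_bot.mpr ?_)
    intro h
    rw [LinearMap.range_eq_bot] at h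
    obtain ⟨v, hv⟩ := hi μ
    apply hv
    have := congrArg (fun f => f v) h
    simpa [S, sub_eq_zero] using this
  have key : ∀ U : Submodule ℝ V, Odd (Module.finrank ℝ U) → Module.finrank ℝ U < n →
      (∀ j, ∀ x ∈ U, T j x ∈ U) → ∃ v : V, v ≠ 0 ∧ ∀ i, ∃ μ : ℝ, T i v = μ • v := by
    intro U hU hlt hinv
    obtain ⟨v, hv, h⟩ := ih _ hlt (V := U) rfl hU (fun j => (T j).restrict (hinv j)) (by
      intro a b
      ext x
      have := congrArg (fun f => f (x : V)) (hT a b).eq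
      simpa using this)
    refine ⟨v, by simpa using hv, fun i => ?_⟩
    obtain ⟨μ, hμ⟩ := h i
    refine ⟨μ, ?_⟩
    have := congrArg Subtype.val hμ
    simpa using this
  have hcomm : ∀ j x, T j (S x) = S (T j x) := fun j x => by
    have := congrArg (fun f => f x) (hS j).eq
    simpa using this
  rw [hn] at hrn
  rcases Nat.even_or_odd (Module.finrank ℝ (LinearMap.ker S)) with he | ho
  · refine key (LinearMap.range S) ?_ (by omega) ?_
    · rw [← hrn] at hodd
      by_contra hcon
      exact (Nat.not_odd_iff_even.mpr ((Nat.not_odd_iff_even.mp hcon).add he)) hodd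
    · rintro j _ ⟨x, rfl⟩
      exact ⟨T j x, (hcomm j x).symm⟩
  · refine key (LinearMap.ker S) ho (by omega) ?_
    intro j x hx
    rw [LinearMap.mem_ker] at hx ⊢
    rw [← hcomm, hx, map_zero]

/-- Perturbing a linearly independent family. -/
theorem pert_indep {V : Type*} [AddCommGroup V] [Module ℝ V] {ι : Type} [Fintype ι]
    (p q : ι → V) (hq : LinearIndependent ℝ q) :
    ∀ᶠ ε : ℝ in Filter.cofinite, LinearIndependent ℝ (fun i => p i + ε • q i) := by
  classical
  obtain ⟨φ, hφ⟩ : ∃ φ : V →ₗ[ℝ] (ι → ℝ), ∀ i, φ (q i) = Pi.single i 1 := by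
    obtain ⟨g, hg⟩ := (Fintype.linearCombination ℝ q).exists_leftInverse_of_injective
      (LinearMap.ker_eq_bot.mpr hq.fintypeLinearCombination_injective)
    refine ⟨g, fun i => ?_⟩
    have := congrArg (fun f => f (Pi.single i 1)) hg
    simpa [Fintype.linearCombination_apply_single] using this
  let M : Matrix ι ι ℝ := Matrix.of fun i => φ (p i)
  have hfin : {ε : ℝ | ¬ LinearIndependent ℝ (fun i => p i + ε • q i)} ⊆
      ((-M).charpoly.roots.toFinset : Set ℝ) := by
    intro ε hε
    by_contra hcon
    apply hε
    have hroot : ¬ (-M).charpoly.IsRoot ε := by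
      intro h
      apply hcon
      simp only [Finset.mem_coe, Multiset.mem_toFinset]
      exact (Polynomial.mem_roots (Matrix.charpoly_monic (-M)).ne_zero).mpr h
    rw [Polynomial.IsRoot, Matrix.eval_charpoly] at hroot
    apply LinearIndependent.of_comp φ
    have hu : IsUnit (Matrix.scalar ι ε - -M) := by
      rw [Matrix.isUnit_iff_isUnit_det]
      exact isUnit_iff_ne_zero.mpr hroot
    have := Matrix.linearIndependent_rows_of_isUnit hu
    rw [sub_neg_eq_add] at this
    convert this using 1
    ext i j
    simp [M, hφ, Matrix.row, Matrix.add_apply, Matrix.scalar_apply, Matrix.diagonal_apply, Pi.single_apply, add_comm,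
      eq_comm]
  exact Set.Finite.subset (Finset.finite_toSet _) hfin

/-- Dimension count for images. -/
theorem finrank_map_add {V W : Type*} [AddCommGroup V] [Module ℝ V] [AddCommGroup W] [Module ℝ W]
    (f : V →ₗ[ℝ] W) (K P : Submodule ℝ V) [FiniteDimensional ℝ P] (hKP : K ≤ P) :
    Module.finrank ℝ (P.map f) + Module.finrank ℝ K ≤
      Module.finrank ℝ (K.map f) + Module.finrank ℝ P := by
  obtain ⟨Q, hQ⟩ := Submodule.exists_isCompl (K.comap P.subtype)
  have : FiniteDimensional ℝ K := Submodule.finiteDimensional_of_le hKP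
  have h1 := Submodule.finrank_add_eq_of_isCompl hQ
  have h2 : Module.finrank ℝ (K.comap P.subtype) = Module.finrank ℝ K :=
    (Submodule.comapSubtypeEquivOfLe hKP).finrank_eq
  have h3 : P.map f = K.map f ⊔ (Q.map P.subtype).map f := by
    rw [← Submodule.map_sup]
    congr 1
    have h4 : (K.comap P.subtype ⊔ Q).map P.subtype = P := by
      rw [hQ.sup_eq_top]; simp
    rw [Submodule.map_sup, Submodule.map_comap_subtype, inf_eq_right.mpr hKP] at h4
    exact h4.symm
  have h5 : Module.finrank ℝ ((Q.map P.subtype).map f) ≤ Module.finrank ℝ Q :=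
    (Submodule.finrank_map_le f _).trans (Submodule.finrank_map_le _ _)
  have h6 := Submodule.finrank_add_le_finrank_add_finrank (K.map f) ((Q.map P.subtype).map f)
  rw [h3]
  omega

end OddBezout

namespace OddBezout

open MvPolynomial

set_option linter.unusedSectionVars false

variable {G : Type} [Fintype G] [DecidableEq G]

abbrev Sg (N : G → ℕ) := MvPolynomial (Σ g, Fin (N g)) ℝ

/-- unit multidegree -/
def un (g : G) : G → ℕ := Pi.single g 1

def wt (N : G → ℕ) : (Σ g, Fin (N g)) → (G → ℕ) := fun v => un v.1

/-- multigraded piece -/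
def pc (N : G → ℕ) (t : G → ℕ) : Submodule ℝ (Sg N) := weightedHomogeneousSubmodule ℝ (wt N) t

theorem weight_apply (N : G → ℕ) (d : (Σ g, Fin (N g)) →₀ ℕ) (g : G) :
    Finsupp.weight (wt N) d g = ∑ a, d ⟨g, a⟩ := by
  rw [Finsupp.weight_apply, Finsupp.sum_fintype _ _ (by simp)]
  simp only [Finset.sum_apply, Pi.smul_apply, smul_eq_mul, wt, un]
  rw [Fintype.sum_sigma]
  rw [Finset.sum_eq_single g]
  · simp
  · intro b _ hb
    simp [hb.symm]
  · simp

noncomputable def monEquiv (N : G → ℕ) (t : G → ℕ) :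
    {d : (Σ g, Fin (N g)) →₀ ℕ | Finsupp.weight (wt N) d = t} ≃
      ((g : G) → {f : Fin (N g) → ℕ // ∑ a, f a = t g}) where
  toFun d g := ⟨fun a => d.1 ⟨g, a⟩, by
    rw [← weight_apply]; exact congrFun d.2 g⟩
  invFun f := ⟨Finsupp.equivFunOnFinite.symm fun v => (f v.1).1 v.2, by
    funext g
    rw [weight_apply]
    exact (f g).2⟩
  left_inv d := by
    ext v; rfl
  right_inv f := by
    ext g a; rfl

theorem card_one (n k : ℕ) : Nat.card {f : Fin n → ℕ // ∑ a, f a = k} = n.multichoose k := by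
  rw [← Nat.card_congr (Sym.equivNatSumOfFintype (Fin n) k), Nat.card_eq_fintype_card,
    Sym.card_sym_fin_eq_multichoose]

theorem finite_one (n k : ℕ) : Finite {f : Fin n → ℕ // ∑ a, f a = k} :=
  Finite.of_equiv _ (Sym.equivNatSumOfFintype (Fin n) k)

theorem finite_mon (N : G → ℕ) (t : G → ℕ) :
    Finite {d : (Σ g, Fin (N g)) →₀ ℕ | Finsupp.weight (wt N) d = t} := by
  have := fun g => finite_one (N g) (t g)
  exact Finite.of_equiv _ (monEquiv N t).symm

noncomputable def pcEquiv (N : G → ℕ) (t : G → ℕ) : pc N t ≃ₗ[ℝ]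
    ({d : (Σ g, Fin (N g)) →₀ ℕ | Finsupp.weight (wt N) d = t} →₀ ℝ) :=
  (LinearEquiv.ofEq _ _ (weightedHomogeneousSubmodule_eq_finsupp_supported ℝ (wt N) t)).trans
    (AddMonoidAlgebra.supportedEquivFinsupp _)

instance pc_fd (N : G → ℕ) (t : G → ℕ) : FiniteDimensional ℝ (pc N t) := by
  have := finite_mon N t
  exact Module.Finite.equiv (pcEquiv N t).symm

theorem finrank_pc (N : G → ℕ) (t : G → ℕ) :
    Module.finrank ℝ (pc N t) = ∏ g, (N g).multichoose (t g) := by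
  have := finite_mon N t
  have := Fintype.ofFinite {d : (Σ g, Fin (N g)) →₀ ℕ | Finsupp.weight (wt N) d = t}
  rw [(pcEquiv N t).finrank_eq, Module.finrank_finsupp_self, ← Nat.card_eq_fintype_card,
    Nat.card_congr (monEquiv N t), Nat.card_pi]
  simp only [card_one]


theorem mul_pc {N : G → ℕ} {t u : G → ℕ} {x y : Sg N} (hx : x ∈ pc N t) (hy : y ∈ pc N u) :
    x * y ∈ pc N (t + u) :=
  IsWeightedHomogeneous.mul (w := wt N) hx hy

theorem X_pc {N : G → ℕ} (g : G) (a : Fin (N g)) : (X ⟨g, a⟩ : Sg N) ∈ pc N (un g) :=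
  isWeightedHomogeneous_X ℝ (wt N) ⟨g, a⟩

/-- generators with declared multidegree -/
abbrev Gens (N : G → ℕ) := Set ((G → ℕ) × Sg N)

def Hom {N : G → ℕ} (J : Gens N) : Prop := ∀ p ∈ J, p.2 ∈ pc N p.1

/-- Graded piece of the ideal generated by `J`. -/
noncomputable def Jp {N : G → ℕ} (J : Gens N) (t : G → ℕ) : Submodule ℝ (Sg N) :=
  Submodule.span ℝ {x | ∃ p ∈ J, ∃ u, p.1 + u = t ∧ ∃ y ∈ pc N u, x = p.2 * y}

theorem mem_Jp {N : G → ℕ} {J : Gens N} {d u : G → ℕ} {f y : Sg N} (h : (d, f) ∈ J)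
    (hy : y ∈ pc N u) : f * y ∈ Jp J (d + u) :=
  Submodule.subset_span ⟨(d, f), h, u, rfl, y, hy, rfl⟩

theorem Jp_le {N : G → ℕ} {J : Gens N} (hJ : Hom J) (t : G → ℕ) : Jp J t ≤ pc N t := by
  refine Submodule.span_le.mpr ?_
  rintro _ ⟨p, hp, u, rfl, y, hy, rfl⟩
  exact mul_pc (hJ p hp) hy

theorem Jp_mono {N : G → ℕ} {J J' : Gens N} (h : J ⊆ J') (t : G → ℕ) : Jp J t ≤ Jp J' t := by
  refine Submodule.span_mono ?_
  rintro _ ⟨p, hp, r⟩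
  exact ⟨p, h hp, r⟩

theorem mul_Jp {N : G → ℕ} {J : Gens N} {t d : G → ℕ} {a x : Sg N} (ha : a ∈ pc N d)
    (hx : x ∈ Jp J t) : a * x ∈ Jp J (d + t) := by
  refine Submodule.span_induction (p := fun x _ => a * x ∈ Jp J (d + t)) ?_ ?_ ?_ ?_ hx
  · rintro _ ⟨⟨e, f⟩, hp, u, rfl, y, hy, rfl⟩
    have := mem_Jp hp (mul_pc ha hy)
    convert this using 1
    · congr 1
      funext g; simp only [Pi.add_apply]; ring
    · simp only; ring
  · simp
  · intro x y _ _ hx hy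
    rw [mul_add]; exact Submodule.add_mem _ hx hy
  · intro c x _ hx
    rw [mul_smul_comm]; exact Submodule.smul_mem _ _ hx

noncomputable def hd {N : G → ℕ} (J : Gens N) (t : G → ℕ) : ℤ :=
  (Module.finrank ℝ (pc N t) : ℤ) - Module.finrank ℝ (Jp J t)

theorem Jp_fd {N : G → ℕ} {J : Gens N} (hJ : Hom J) (t : G → ℕ) :
    FiniteDimensional ℝ (Jp J t) := Submodule.finiteDimensional_of_le (Jp_le hJ t)

theorem hd_nonneg {N : G → ℕ} {J : Gens N} (hJ : Hom J) (t : G → ℕ) : 0 ≤ hd J t := by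
  have := Submodule.finrank_mono (Jp_le hJ t)
  unfold hd; omega

theorem hd_anti {N : G → ℕ} {J J' : Gens N} (h : J ⊆ J') (hJ' : Hom J') (t : G → ℕ) :
    hd J' t ≤ hd J t := by
  have := Jp_fd hJ' t
  have := Submodule.finrank_mono (Jp_mono h t)
  unfold hd; omega

theorem Hom.insert {N : G → ℕ} {J : Gens N} (hJ : Hom J) {d : G → ℕ} {a : Sg N}
    (ha : a ∈ pc N d) : Hom (insert (d, a) J) := by
  rintro p (rfl | hp)
  · exact ha
  · exact hJ p hp

theorem Jp_insert {N : G → ℕ} (J : Gens N) (d t : G → ℕ) (a : Sg N) :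
    Jp (insert (d, a) J) (d + t) = Jp J (d + t) ⊔ (pc N t).map (LinearMap.mulLeft ℝ a) := by
  apply le_antisymm
  · refine Submodule.span_le.mpr ?_
    rintro _ ⟨p, (rfl | hp), u, hu, y, hy, rfl⟩
    · have : u = t := by simpa using hu
      subst this
      exact Submodule.mem_sup_right ⟨y, hy, rfl⟩
    · exact Submodule.mem_sup_left (Submodule.subset_span ⟨p, hp, u, hu, y, hy, rfl⟩)
  · refine sup_le (Jp_mono (Set.subset_insert _ _) _) ?_
    rintro _ ⟨y, hy, rfl⟩
    exact mem_Jp (Set.mem_insert _ _) hy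

/-- Right exactness: the basic dimension estimate. -/
theorem right_exact {N : G → ℕ} {J K : Gens N} (hJ : Hom J) (hK : Hom K) {d t : G → ℕ} {a : Sg N}
    (h : ∀ x ∈ Jp K t, a * x ∈ Jp J (d + t)) :
    hd J (d + t) ≤ hd (insert (d, a) J) (d + t) + hd K t := by
  have := Jp_fd hJ (d + t)
  have h1 := finrank_map_add (LinearMap.mulLeft ℝ a) (Jp K t) (pc N t) (Jp_le hK t)
  have h2 := Submodule.finrank_sup_add_finrank_inf_eq (Jp J (d + t))
    ((pc N t).map (LinearMap.mulLeft ℝ a))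
  have h3 : Module.finrank ℝ ((Jp K t).map (LinearMap.mulLeft ℝ a)) ≤
      Module.finrank ℝ ((Jp J (d + t)) ⊓ ((pc N t).map (LinearMap.mulLeft ℝ a)) : Submodule _ _) := by
    apply Submodule.finrank_mono
    refine le_inf ?_ (Submodule.map_mono (Jp_le hK t))
    rintro _ ⟨x, hx, rfl⟩
    exact h x hx
  unfold hd
  rw [Jp_insert]
  omega

/-- Case of multiplication by `a`. -/
theorem exact_a {N : G → ℕ} {J : Gens N} (hJ : Hom J) {d t : G → ℕ} {a : Sg N}
    (ha : a ∈ pc N d) : hd J (d + t) ≤ hd (insert (d, a) J) (d + t) + hd J t :=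
  right_exact hJ hJ fun _ hx => mul_Jp ha hx

/-- Case of a product `a * b`. -/
theorem exact_ab {N : G → ℕ} {J : Gens N} (hJ : Hom J) {d e t : G → ℕ} {a b : Sg N}
    (ha : a ∈ pc N d) (hb : b ∈ pc N e) :
    hd (insert (d + e, a * b) J) (d + t) ≤ hd (insert (d, a) J) (d + t) + hd (insert (e, b) J) t := by
  have hab := mul_pc ha hb
  refine (right_exact (hJ.insert hab) (hJ.insert hb) (d := d) (t := t) (a := a) ?_).trans ?_
  · intro x hx
    refine Submodule.span_induction (p := fun x _ => a * x ∈ Jp _ (d + t)) ?_ ?_ ?_ ?_ hx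
    · rintro _ ⟨p, (rfl | hp), u, rfl, y, hy, rfl⟩
      · have := mem_Jp (J := insert (d + e, a * b) J) (Set.mem_insert _ _) hy
        simpa only [mul_assoc, add_assoc] using this
      · refine mul_Jp ha ?_
        exact mem_Jp (Set.mem_insert_of_mem _ hp) hy
    · simp
    · intro x y _ _ hx hy
      rw [mul_add]; exact Submodule.add_mem _ hx hy
    · intro c x _ hx
      rw [mul_smul_comm]; exact Submodule.smul_mem _ _ hx
  · refine add_le_add_left ?_ _
    refine hd_anti (Set.insert_subset_insert (Set.subset_insert _ _)) ?_ _
    exact (hJ.insert hab).insert ha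

/-- Semicontinuity under a perturbation `f + ε g`. -/
theorem semicont {N : G → ℕ} (T : Set ((G → ℕ) × Sg N × Sg N))
    (hf : ∀ p ∈ T, p.2.1 ∈ pc N p.1) (hg : ∀ p ∈ T, p.2.2 ∈ pc N p.1) (t : G → ℕ) :
    ∀ᶠ ε : ℝ in Filter.cofinite,
      hd ((fun p => (p.1, p.2.1 + ε • p.2.2)) '' T) t ≤ hd ((fun p => (p.1, p.2.2)) '' T) t := by
  have hom1 : Hom ((fun p : (G → ℕ) × Sg N × Sg N => (p.1, p.2.2)) '' T) := by
    rintro _ ⟨p, hp, rfl⟩; exact hg p hp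
  have hom2 : ∀ ε : ℝ,
      Hom ((fun p : (G → ℕ) × Sg N × Sg N => (p.1, p.2.1 + ε • p.2.2)) '' T) := by
    rintro ε _ ⟨p, hp, rfl⟩
    exact Submodule.add_mem _ (hf p hp) (Submodule.smul_mem _ _ (hg p hp))
  obtain ⟨b, hbs, hspan, hli⟩ := exists_linearIndependent ℝ
    {x | ∃ p ∈ ((fun p : (G → ℕ) × Sg N × Sg N => (p.1, p.2.2)) '' T), ∃ u, p.1 + u = t ∧
      ∃ y ∈ pc N u, x = p.2 * y}
  have hspan' : Submodule.span ℝ b = Jp ((fun p : (G → ℕ) × Sg N × Sg N => (p.1, p.2.2)) '' T) t :=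
    hspan
  have fd := Jp_fd hom1 t
  have hbfin : Finite b := by
    rw [← hspan'] at fd
    have h2 : LinearIndependent ℝ (fun x : b => (⟨x, Submodule.subset_span x.2⟩ : Submodule.span ℝ b)) :=
      LinearIndependent.of_comp (Submodule.span ℝ b).subtype hli
    exact h2.finite
  have := Fintype.ofFinite b
  have hb : ∀ x : b, ∃ p ∈ T, ∃ u, p.1 + u = t ∧ ∃ y ∈ pc N u, (x : Sg N) = p.2.2 * y := by
    intro x
    obtain ⟨_, ⟨p, hp, rfl⟩, u, hu, y, hy, h⟩ := hbs x.2
    exact ⟨p, hp, u, hu, y, hy, h⟩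
  choose p hp u hu y hy h using hb
  have hcard : Module.finrank ℝ (Jp ((fun p : (G → ℕ) × Sg N × Sg N => (p.1, p.2.2)) '' T) t) =
      Fintype.card b := by
    rw [← hspan']
    have := finrank_span_eq_card hli
    rwa [Subtype.range_coe] at this
  obtain ⟨e⟩ := Fintype.truncEquivFin b |>.nonempty
  have := pert_indep (fun i => (p (e.symm i)).2.1 * y (e.symm i)) (fun i => ((e.symm i : b) : Sg N))
    (hli.comp _ e.symm.injective)
  filter_upwards [this] with ε hε
  have := Jp_fd (hom2 ε) t
  have h5 : Submodule.span ℝ (Set.range (fun i => (p (e.symm i)).2.1 * y (e.symm i) +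
      ε • ((e.symm i : b) : Sg N))) ≤ Jp ((fun p => (p.1, p.2.1 + ε • p.2.2)) '' T) t := by
    rw [Submodule.span_le]
    rintro _ ⟨i, rfl⟩
    have := mem_Jp (J := ((fun p => (p.1, p.2.1 + ε • p.2.2)) '' T))
      ⟨p (e.symm i), hp _, rfl⟩ (hy (e.symm i))
    rw [hu] at this
    simp only
    rw [h (e.symm i), ← smul_mul_assoc, ← add_mul]
    exact this
  have h6 := Submodule.finrank_mono h5
  rw [finrank_span_eq_card hε, Fintype.card_fin] at h6
  unfold hd
  omega

end OddBezout

namespace OddBezout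

open MvPolynomial

set_option linter.unusedSectionVars false

variable {G : Type} [Fintype G] [DecidableEq G]

/-- expected Hilbert function -/
def W : List (G × G) → (G → ℕ) → (G → ℕ) → ℤ
  | [], q, t => ∏ g, ((q g).multichoose (t g) : ℤ)
  | (i, j) :: L, q, t => W L (q - un i) t + W L (q - un j) (t - un i)

@[simp] theorem un_self (g : G) : un g g = 1 := by simp [un]
theorem un_ne {g h : G} (H : h ≠ g) : un g h = 0 := by simp [un, H]
theorem un_le (g h : G) : un g h ≤ 1 := by
  by_cases H : h = g
  · subst H; simp
  · simp [un_ne H]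

theorem mc_zero {k : ℕ} (hk : 1 ≤ k) : Nat.multichoose 0 k = 0 := by
  obtain ⟨k, rfl⟩ := Nat.exists_eq_add_of_le' hk
  simp

theorem W_diff (L : List (G × G)) : ∀ (q t : G → ℕ) (i : G), (∀ g, L.length + 1 ≤ t g) →
    W L q (t + un i) = W L (q - un i) (t + un i) + W L q t := by
  induction L with
  | nil =>
    intro q t i ht
    simp only [W]
    rw [← Finset.mul_prod_erase _ _ (Finset.mem_univ i), ← Finset.mul_prod_erase _ _ (Finset.mem_univ i),
      ← Finset.mul_prod_erase _ _ (Finset.mem_univ i)]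
    have h1 : ∏ x ∈ Finset.univ.erase i, (((q x).multichoose ((t + un i) x) : ℕ) : ℤ) =
      ∏ x ∈ Finset.univ.erase i, (((q x).multichoose (t x) : ℕ) : ℤ) := by
      refine Finset.prod_congr rfl fun x hx => ?_
      simp [un_ne (Finset.ne_of_mem_erase hx)]
    have h2 : ∏ x ∈ Finset.univ.erase i, ((((q - un i) x).multichoose ((t + un i) x) : ℕ) : ℤ) =
      ∏ x ∈ Finset.univ.erase i, (((q x).multichoose (t x) : ℕ) : ℤ) := by
      refine Finset.prod_congr rfl fun x hx => ?_
      simp [un_ne (Finset.ne_of_mem_erase hx)]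
    rw [h1, h2, ← add_mul]
    congr 1
    simp only [Pi.add_apply, Pi.sub_apply, un_self]
    rcases Nat.eq_zero_or_pos (q i) with h | h
    · have := ht i
      simp only [List.length_nil, zero_add] at this
      simp [h, mc_zero this]
    · obtain ⟨k, hk⟩ := Nat.exists_eq_add_of_le' h
      rw [hk, Nat.multichoose_succ_succ]
      simp
  | cons p L ih =>
    obtain ⟨a, b⟩ := p
    intro q t i ht
    simp only [List.length_cons] at ht
    simp only [W]
    have e1 : q - un a - un i = q - un i - un a := tsub_right_comm
    have e2 : q - un b - un i = q - un i - un b := tsub_right_comm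
    have e3 : t + un i - un a = (t - un a) + un i := by
      funext g
      have := ht g
      have := un_le a g
      simp only [Pi.add_apply, Pi.sub_apply]
      omega
    rw [ih (q - un a) t i (fun g => by have := ht g; omega), e3,
      ih (q - un b) (t - un a) i (fun g => by
        have := ht g
        have := un_le a g
        simp only [Pi.sub_apply]
        omega), e1, e2]
    ring

theorem W_step (L : List (G × G)) (q t : G → ℕ) (i j : G) (ht : ∀ g, L.length + 1 ≤ t g) :
    W ((i, j) :: L) q (un i + un j + t) = W L q (un i + un j + t) - W L q t := by
  have e1 : un i + un j + t = (t + un j) + un i := by abel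
  have e2 : un i + un j + t - un i = t + un j := by
    funext g; simp only [Pi.add_apply, Pi.sub_apply]; omega
  simp only [W]
  rw [e2, e1]
  have h1 := W_diff L q (t + un j) i (fun g => by have := ht g; simp only [Pi.add_apply]; omega)
  have h2 := W_diff L q t j ht
  linarith

theorem W_zero (L : List (G × G)) : ∀ (q t : G → ℕ) (g : G), q g = 0 → (∀ g, L.length + 1 ≤ t g) →
    W L q t = 0 := by
  induction L with
  | nil =>
    intro q t g hg ht
    simp only [W]
    refine Finset.prod_eq_zero (Finset.mem_univ g) ?_
    have := ht g
    simp only [List.length_nil, zero_add] at this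
    rw [hg, mc_zero this]; rfl
  | cons p L ih =>
    obtain ⟨a, b⟩ := p
    intro q t g hg ht
    simp only [List.length_cons] at ht
    simp only [W]
    rw [ih (q - un a) t g (by simp [hg]) (fun g => by have := ht g; omega),
      ih (q - un b) (t - un a) g (by simp [hg]) (fun g => by
        have := ht g
        have := un_le a g
        simp only [Pi.sub_apply]
        omega)]
    rfl

theorem sum_sub_un (q : G → ℕ) (i : G) (h : 1 ≤ q i) : ∑ g, (q - un i) g + 1 = ∑ g, q g := by
  rw [← Finset.add_sum_erase _ _ (Finset.mem_univ i), ← Finset.add_sum_erase _ q (Finset.mem_univ i)]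
  have : ∑ x ∈ Finset.univ.erase i, (q - un i) x = ∑ x ∈ Finset.univ.erase i, q x := by
    refine Finset.sum_congr rfl fun x hx => ?_
    simp [un_ne (Finset.ne_of_mem_erase hx)]
  rw [this]
  simp only [Pi.sub_apply, un_self]
  omega

theorem W_small (L : List (G × G)) : ∀ (q t : G → ℕ), ∑ g, q g < L.length + Fintype.card G →
    (∀ g, L.length + 1 ≤ t g) → W L q t = 0 := by
  induction L with
  | nil =>
    intro q t hq ht
    obtain ⟨g, hg⟩ : ∃ g, q g = 0 := by
      by_contra! hcon
      have : ∑ g : G, 1 ≤ ∑ g, q g :=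
        Finset.sum_le_sum fun g _ => Nat.one_le_iff_ne_zero.mpr (hcon g)
      simp at this hq
      omega
    exact W_zero [] q t g hg ht
  | cons p L ih =>
    obtain ⟨a, b⟩ := p
    intro q t hq ht
    by_cases h0 : ∃ g, q g = 0
    · obtain ⟨g, hg⟩ := h0
      exact W_zero _ q t g hg ht
    push Not at h0
    simp only [List.length_cons] at ht hq
    simp only [W]
    have ha := sum_sub_un q a (Nat.one_le_iff_ne_zero.mpr (h0 a))
    have hb := sum_sub_un q b (Nat.one_le_iff_ne_zero.mpr (h0 b))
    rw [ih (q - un a) t (by omega) (fun g => by have := ht g; omega),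
      ih (q - un b) (t - un a) (by omega) (fun g => by
        have := ht g
        have := un_le a g
        simp only [Pi.sub_apply]
        omega)]
    rfl

/-- The generating polynomial. -/
noncomputable def genP (L : List (G × G)) : MvPolynomial G ℤ :=
  (L.map fun p => X p.1 + X p.2).prod * ∏ g, X g

noncomputable def cf (q : G → ℕ) (L : List (G × G)) : ℤ :=
  coeff (Finsupp.equivFunOnFinite.symm q) (genP L)

theorem cf_zero (L : List (G × G)) (q : G → ℕ) (g : G) (h : q g = 0) : cf q L = 0 := by
  unfold cf genP
  rw [← Finset.mul_prod_erase _ _ (Finset.mem_univ g), mul_left_comm, coeff_X_mul']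
  simp [h]

theorem prod_X_eq : (∏ g, X g : MvPolynomial G ℤ) = monomial (Finsupp.equivFunOnFinite.symm 1) 1 := by
  rw [monomial_eq]
  simp [Finsupp.prod_fintype]

theorem W_eq (L : List (G × G)) : ∀ (q t : G → ℕ), ∑ g, q g = L.length + Fintype.card G →
    (∀ g, L.length + 1 ≤ t g) → W L q t = cf q L := by
  induction L with
  | nil =>
    intro q t hq ht
    by_cases h0 : ∃ g, q g = 0
    · obtain ⟨g, hg⟩ := h0
      rw [W_zero _ q t g hg ht, cf_zero _ _ g hg]
    push Not at h0
    have h1 : q = 1 := by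
      have h2 : ∑ g : G, 1 = ∑ g, q g := by simpa using hq.symm
      rw [Finset.sum_eq_sum_iff_of_le (fun g _ => Nat.one_le_iff_ne_zero.mpr (h0 g))] at h2
      funext g
      exact (h2 g (Finset.mem_univ g)).symm
    subst h1
    simp [W, cf, genP, prod_X_eq]
  | cons p L ih =>
    obtain ⟨a, b⟩ := p
    intro q t hq ht
    by_cases h0 : ∃ g, q g = 0
    · obtain ⟨g, hg⟩ := h0
      rw [W_zero _ q t g hg ht, cf_zero _ _ g hg]
    push Not at h0
    simp only [List.length_cons] at ht hq
    simp only [W]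
    have ha := sum_sub_un q a (Nat.one_le_iff_ne_zero.mpr (h0 a))
    have hb := sum_sub_un q b (Nat.one_le_iff_ne_zero.mpr (h0 b))
    rw [ih (q - un a) t (by omega) (fun g => by have := ht g; omega),
      ih (q - un b) (t - un a) (by omega) (fun g => by
        have := ht g
        have := un_le a g
        simp only [Pi.sub_apply]
        omega)]
    have e : genP ((a, b) :: L) = X a * genP L + X b * genP L := by
      simp [genP]; ring
    have e2 : ∀ c, Finsupp.equivFunOnFinite.symm (q - un c) =
        Finsupp.equivFunOnFinite.symm q - Finsupp.single c 1 := by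
      intro c
      ext g
      simp [un, Finsupp.single_apply, Pi.single_apply, eq_comm]
    unfold cf
    rw [e, coeff_add, coeff_X_mul', coeff_X_mul', e2, e2]
    simp [h0]

end OddBezout

namespace OddBezout

open MvPolynomial

set_option linter.unusedSectionVars false

variable {G : Type} [Fintype G] [DecidableEq G]

noncomputable def lam (N : G → ℕ) (g : G) (τ : ℕ) : Sg N :=
  ∑ a : Fin (N g), ((τ : ℝ) ^ (a : ℕ)) • X ⟨g, a⟩

theorem lam_pc (N : G → ℕ) (g : G) (τ : ℕ) : lam N g τ ∈ pc N (un g) :=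
  Submodule.sum_mem _ fun a _ => Submodule.smul_mem _ _ (X_pc g a)

def lin (N : G → ℕ) (P : Finset (G × ℕ)) : Gens N :=
  (fun p => (un p.1, lam N p.1 p.2)) '' (P : Set (G × ℕ))

theorem lin_hom (N : G → ℕ) (P : Finset (G × ℕ)) : Hom (lin N P) := by
  rintro _ ⟨p, _, rfl⟩
  exact lam_pc _ _ _

theorem lin_insert (N : G → ℕ) (P : Finset (G × ℕ)) (g : G) (τ : ℕ) :
    lin N (insert (g, τ) P) = insert (un g, lam N g τ) (lin N P) := by
  simp [lin, Set.image_insert_eq]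

def cnt (P : Finset (G × ℕ)) : G → ℕ := fun g => (P.filter fun p => p.1 = g).card

theorem cnt_insert (P : Finset (G × ℕ)) (g : G) (τ : ℕ) (h : (g, τ) ∉ P) :
    cnt (insert (g, τ) P) = cnt P + un g := by
  funext x
  simp only [cnt, Pi.add_apply]
  rw [Finset.filter_insert]
  by_cases hx : g = x
  · subst hx
    simp [h]
  · simp [hx, un_ne (Ne.symm hx)]

theorem X_span (N : G → ℕ) (P : Finset (G × ℕ)) (g : G) (h : N g ≤ cnt P g) (a : Fin (N g)) :
    (X ⟨g, a⟩ : Sg N) ∈ Submodule.span ℝ {x | ∃ τ, (g, τ) ∈ P ∧ x = lam N g τ} := by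
  have h1 : N g ≤ ((P.filter fun p => p.1 = g).image Prod.snd).card := by
    rw [Finset.card_image_of_injOn]
    · exact h
    · rintro ⟨x, y⟩ hx ⟨x', y'⟩ hx' hh
      simp only [Finset.coe_filter, Set.mem_ofPred_eq] at hx hx' hh
      rw [hx.2, hx'.2, hh]
  obtain ⟨Q, hQ, hQc⟩ := Finset.exists_subset_card_eq h1
  let v : Fin (N g) → ℝ := fun i => (Q.orderEmbOfFin hQc i : ℕ)
  have hv : Function.Injective v := fun i j hij => by
    simpa [v] using hij
  have hdet : (Matrix.vandermonde v).det ≠ 0 := Matrix.det_vandermonde_ne_zero_iff.mpr hv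
  have hu : IsUnit (Matrix.vandermonde v).det := isUnit_iff_ne_zero.mpr hdet
  have key : (X ⟨g, a⟩ : Sg N) =
      ∑ i, ((Matrix.vandermonde v)⁻¹ a i) • lam N g (Q.orderEmbOfFin hQc i) := by
    have e : ∀ i, lam N g (Q.orderEmbOfFin hQc i) = ∑ b, (Matrix.vandermonde v i b) • X ⟨g, b⟩ := by
      intro i
      rfl
    simp_rw [e, Finset.smul_sum, smul_smul]
    rw [Finset.sum_comm]
    simp_rw [← Finset.sum_smul]
    have : ∀ b, ∑ i, (Matrix.vandermonde v)⁻¹ a i * Matrix.vandermonde v i b =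
        (1 : Matrix _ _ ℝ) a b := by
      intro b
      rw [← Matrix.nonsing_inv_mul _ hu, Matrix.mul_apply]
    simp_rw [this, Matrix.one_apply]
    simp
  rw [key]
  refine Submodule.sum_mem _ fun i _ => Submodule.smul_mem _ _ (Submodule.subset_span ?_)
  refine ⟨_, ?_, rfl⟩
  have := hQ (Q.orderEmbOfFin_mem hQc i)
  simp only [Finset.mem_image, Finset.mem_filter, Prod.exists] at this
  obtain ⟨x, y, ⟨hxy, hxg⟩, h3⟩ := this
  rw [← h3, ← hxg]; exact hxy

theorem lin_full (N : G → ℕ) (P : Finset (G × ℕ)) (g : G) (h : N g ≤ cnt P g) (t : G → ℕ)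
    (ht : 1 ≤ t g) : hd (lin N P) t = 0 := by
  have : pc N t ≤ Jp (lin N P) t := by
    intro f hf
    rw [← support_sum_monomial_coeff f]
    refine Submodule.sum_mem _ fun d hd => ?_
    have hw : Finsupp.weight (wt N) d = t := hf (mem_support_iff.mp hd)
    obtain ⟨a, ha⟩ : ∃ a, 1 ≤ d ⟨g, a⟩ := by
      by_contra! hcon
      have := congrFun hw g
      rw [weight_apply, Finset.sum_eq_zero (fun a _ => by have := hcon a; omega)] at this
      omega
    have e : monomial d (coeff d f) = X ⟨g, a⟩ * monomial (d - Finsupp.single ⟨g, a⟩ 1) (coeff d f) := by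
      rw [mul_comm, X, monomial_mul, mul_one, tsub_add_cancel_of_le]
      rwa [Finsupp.single_le_iff]
    have hle : Finsupp.single ⟨g, a⟩ 1 ≤ d := by rwa [Finsupp.single_le_iff]
    have hw2 : un g + Finsupp.weight (wt N) (d - Finsupp.single ⟨g, a⟩ 1) = t := by
      rw [← hw]
      conv_rhs => rw [← add_tsub_cancel_of_le hle, map_add]
      simp [Finsupp.weight_single, wt]
    have hm : monomial (d - Finsupp.single ⟨g, a⟩ 1) (coeff d f) ∈
        pc N (Finsupp.weight (wt N) (d - Finsupp.single ⟨g, a⟩ 1)) :=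
      isWeightedHomogeneous_monomial _ _ _ rfl
    rw [e, ← hw2]
    refine Submodule.span_induction (p := fun x _ => x * _ ∈ Jp (lin N P) _) ?_ ?_ ?_ ?_
      (X_span N P g h a)
    · rintro _ ⟨τ, hτ, rfl⟩
      exact mem_Jp ⟨(g, τ), hτ, rfl⟩ hm
    · simp
    · intro x y _ _ hx hy
      rw [add_mul]; exact Submodule.add_mem _ hx hy
    · intro c x _ hx
      rw [smul_mul_assoc]; exact Submodule.smul_mem _ _ hx
  have h2 := le_antisymm this (Jp_le (lin_hom N P) t)
  unfold hd
  rw [h2]; simp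

theorem lin_bound (N : G → ℕ) (n : ℕ) : ∀ (P : Finset (G × ℕ)) (t : G → ℕ),
    ∑ g, t g + ∑ g, (N g - cnt P g) = n → hd (lin N P) t ≤ W [] (N - cnt P) t := by
  induction n using Nat.strong_induction_on with
  | _ n ih =>
  intro P t hn
  by_cases h0 : ∀ g, t g = 0
  · have hle : hd (lin N P) t ≤ Module.finrank ℝ (pc N t) := by
      unfold hd; omega
    refine hle.trans ?_
    rw [finrank_pc]
    simp [W, h0]
  push Not at h0
  obtain ⟨g, hg⟩ := h0
  have hg1 : 1 ≤ t g := Nat.one_le_iff_ne_zero.mpr hg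
  rcases Nat.lt_or_ge (cnt P g) (N g) with hlt | hge
  · obtain ⟨τ, hτ⟩ : ∃ τ, (g, τ) ∉ P := by
      obtain ⟨τ, hτ⟩ := Infinite.exists_notMem_finset (P.image Prod.snd)
      exact ⟨τ, fun h => hτ (Finset.mem_image_of_mem Prod.snd h)⟩
    have et : t = un g + (t - un g) := by
      funext x
      simp only [Pi.add_apply, Pi.sub_apply]
      by_cases hx : x = g
      · subst hx; simp; omega
      · simp [un_ne hx]
    have hsub := sum_sub_un (N - cnt P) g (by simp; omega)
    have hsubt := sum_sub_un t g hg1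
    have h1 := exact_a (lin_hom N P) (t := t - un g) (lam_pc N g τ)
    rw [← et, ← lin_insert] at h1
    have ec : N - cnt (insert (g, τ) P) = N - cnt P - un g := by
      rw [cnt_insert _ _ _ hτ, tsub_add_eq_tsub_tsub]
    have hs2 : ∑ x, (N x - cnt (insert (g, τ) P) x) = ∑ x, (N - cnt P - un g) x := by
      rw [← ec]; rfl
    have hs3 : ∑ x, (N x - cnt P x) = ∑ x, (N - cnt P) x := rfl
    have h2 := ih (∑ g, t g + ∑ x, (N - cnt P - un g) x) (by omega) (insert (g, τ) P) t (by omega)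
    have h3 := ih (∑ x, (t - un g) x + ∑ x, (N - cnt P) x) (by omega) P (t - un g) (by omega)
    rw [ec] at h2
    refine h1.trans ((add_le_add h2 h3).trans (le_of_eq ?_))
    simp only [W]
    rw [← Finset.mul_prod_erase _ _ (Finset.mem_univ g), ← Finset.mul_prod_erase _ _ (Finset.mem_univ g),
      ← Finset.mul_prod_erase _ _ (Finset.mem_univ g)]
    have h1 : ∏ x ∈ Finset.univ.erase g, ((((N - cnt P - un g) x).multichoose (t x) : ℕ) : ℤ) =
      ∏ x ∈ Finset.univ.erase g, ((((N - cnt P) x).multichoose (t x) : ℕ) : ℤ) := by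
      refine Finset.prod_congr rfl fun x hx => ?_
      simp [un_ne (Finset.ne_of_mem_erase hx)]
    have h2 : ∏ x ∈ Finset.univ.erase g, ((((N - cnt P) x).multichoose ((t - un g) x) : ℕ) : ℤ) =
      ∏ x ∈ Finset.univ.erase g, ((((N - cnt P) x).multichoose (t x) : ℕ) : ℤ) := by
      refine Finset.prod_congr rfl fun x hx => ?_
      simp [un_ne (Finset.ne_of_mem_erase hx)]
    rw [h1, h2, ← add_mul]
    congr 1
    obtain ⟨k, hk⟩ := Nat.exists_eq_add_of_le' hg1
    obtain ⟨l, hl⟩ : ∃ l, (N - cnt P) g = l + 1 := Nat.exists_eq_add_of_le' (by simp; omega)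
    rw [Pi.sub_apply, Pi.sub_apply t, hl, hk, un_self, Nat.multichoose_succ_succ]
    simp
  · rw [lin_full N P g hge t hg1]
    simp only [W]
    positivity

/-- the special (split) system -/
noncomputable def spec (N : G → ℕ) : List (G × G) → Gens N
  | [] => ∅
  | (i, j) :: L => insert (un i + un j, lam N i (2 * L.length) * lam N j (2 * L.length + 1)) (spec N L)

theorem spec_hom (N : G → ℕ) (L : List (G × G)) : Hom (spec N L) := by
  induction L with
  | nil => rintro p ⟨⟩
  | cons p L ih =>
    obtain ⟨i, j⟩ := p
    exact ih.insert (mul_pc (lam_pc _ _ _) (lam_pc _ _ _))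

theorem hom_union {N : G → ℕ} {J J' : Gens N} (h : Hom J) (h' : Hom J') : Hom (J ∪ J') := by
  rintro p (hp | hp)
  exacts [h p hp, h' p hp]

theorem spec_bound (N : G → ℕ) (L : List (G × G)) : ∀ (P : Finset (G × ℕ)) (t : G → ℕ),
    (∀ p ∈ P, 2 * L.length ≤ p.2) → (∀ g, L.length ≤ t g) →
    hd (spec N L ∪ lin N P) t ≤ W L (N - cnt P) t := by
  induction L with
  | nil =>
    intro P t _ _
    simp only [spec, Set.empty_union]
    exact lin_bound N _ P t rfl
  | cons p L ih =>
    obtain ⟨i, j⟩ := p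
    intro P t hP ht
    simp only [List.length_cons] at hP ht
    have et : t = un i + (t - un i) := by
      funext x
      have := ht x
      have := un_le i x
      simp only [Pi.add_apply, Pi.sub_apply]
      omega
    have hom := hom_union (spec_hom N L) (lin_hom N P)
    have h1 := exact_ab hom (t := t - un i) (lam_pc N i (2 * L.length)) (lam_pc N j (2 * L.length + 1))
    rw [← et] at h1
    have h2 := ih (insert (i, 2 * L.length) P) t (by
      intro p hp
      rcases Finset.mem_insert.mp hp with rfl | hp
      · simp
      · have := hP p hp; omega) (fun g => by have := ht g; omega)
    have h3 := ih (insert (j, 2 * L.length + 1) P) (t - un i) (by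
      intro p hp
      rcases Finset.mem_insert.mp hp with rfl | hp
      · simp
      · have := hP p hp; omega) (fun g => by
        have := ht g
        have := un_le i g
        simp only [Pi.sub_apply]
        omega)
    rw [lin_insert, cnt_insert _ _ _ (fun h => by have := hP _ h; simp only at this; omega),
      Set.union_insert, ← tsub_tsub] at h2 h3
    simp only [spec, W, Set.insert_union]
    linarith

end OddBezout

namespace OddBezout

open MvPolynomial

set_option linter.unusedSectionVars false

variable {G : Type} [Fintype G] [DecidableEq G]

theorem surj_of {N : G → ℕ} {J : Gens N} (hJ : Hom J) {d u : G → ℕ} {l : Sg N} (hl : l ∈ pc N d)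
    (h : hd (insert (d, l) J) (d + u) ≤ 0) {x : Sg N} (hx : x ∈ pc N (d + u)) :
    ∃ w ∈ pc N u, x - l * w ∈ Jp J (d + u) := by
  have hle := Jp_le (hJ.insert hl) (d + u)
  have heq := Submodule.eq_of_le_of_finrank_le hle (by unfold hd at h; omega)
  rw [← heq, Jp_insert] at hx
  obtain ⟨y, hy, _, ⟨w, hw, rfl⟩, rfl⟩ := Submodule.mem_sup.mp hx
  exact ⟨w, hw, by simpa using hy⟩

theorem inj_of {N : G → ℕ} {J : Gens N} (hJ : Hom J) {d u : G → ℕ} {l : Sg N} (hl : l ∈ pc N d)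
    (h : hd (insert (d, l) J) (d + u) ≤ 0) (he : hd J (d + u) = hd J u) {w : Sg N}
    (hw : w ∈ pc N u) (hlw : l * w ∈ Jp J (d + u)) : w ∈ Jp J u := by
  let K : Submodule ℝ (Sg N) := pc N u ⊓ (Jp J (d + u)).comap (LinearMap.mulLeft ℝ l)
  have hK : Jp J u ≤ K := le_inf (Jp_le hJ u) fun x hx => mul_Jp hl hx
  have := Jp_fd hJ (d + u)
  have h1 := finrank_map_add (LinearMap.mulLeft ℝ l) K (pc N u) inf_le_left
  have h2 := Submodule.finrank_sup_add_finrank_inf_eq (Jp J (d + u))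
    ((pc N u).map (LinearMap.mulLeft ℝ l))
  have h3 : Module.finrank ℝ (K.map (LinearMap.mulLeft ℝ l)) ≤
      Module.finrank ℝ ((Jp J (d + u)) ⊓ ((pc N u).map (LinearMap.mulLeft ℝ l)) : Submodule _ _) := by
    apply Submodule.finrank_mono
    refine le_inf ?_ (Submodule.map_mono inf_le_left)
    rintro _ ⟨x, hx, rfl⟩
    exact hx.2
  have : FiniteDimensional ℝ K := Submodule.finiteDimensional_of_le (inf_le_left : K ≤ pc N u)
  have heq : Jp J u = K := by
    refine Submodule.eq_of_le_of_finrank_le hK ?_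
    unfold hd at h he
    rw [Jp_insert] at h
    omega
  rw [heq]
  exact ⟨hw, hlw⟩

def IsBil (N : G → ℕ) (i j : G) (f : Sg N) : Prop :=
  ∃ B : Fin (N i) → Fin (N j) → ℝ, f = ∑ a, ∑ b, B a b • (X ⟨i, a⟩ * X ⟨j, b⟩)

theorem IsBil.pc {N : G → ℕ} {i j : G} {f : Sg N} (h : IsBil N i j f) : f ∈ pc N (un i + un j) := by
  obtain ⟨B, rfl⟩ := h
  exact Submodule.sum_mem _ fun a _ => Submodule.sum_mem _ fun b _ =>
    Submodule.smul_mem _ _ (mul_pc (X_pc i a) (X_pc j b))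

theorem IsBil.add {N : G → ℕ} {i j : G} {f g : Sg N} (h : IsBil N i j f) (h' : IsBil N i j g) :
    IsBil N i j (f + g) := by
  obtain ⟨B, rfl⟩ := h
  obtain ⟨B', rfl⟩ := h'
  refine ⟨B + B', ?_⟩
  simp only [Pi.add_apply, add_smul, Finset.sum_add_distrib]

theorem IsBil.smul {N : G → ℕ} {i j : G} {f : Sg N} (h : IsBil N i j f) (c : ℝ) :
    IsBil N i j (c • f) := by
  obtain ⟨B, rfl⟩ := h
  refine ⟨c • B, ?_⟩
  simp only [Pi.smul_apply, smul_eq_mul, Finset.smul_sum, smul_smul]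

theorem isBil_lam (N : G → ℕ) (i j : G) (σ τ : ℕ) : IsBil N i j (lam N i σ * lam N j τ) := by
  refine ⟨fun a b => (σ : ℝ) ^ (a : ℕ) * (τ : ℝ) ^ (b : ℕ), ?_⟩
  unfold lam
  rw [Finset.sum_mul_sum]
  refine Finset.sum_congr rfl fun a _ => Finset.sum_congr rfl fun b _ => ?_
  rw [smul_mul_smul_comm]

/-- Division operators. -/
theorem exists_op {N : G → ℕ} {J : Gens N} (hJ : Hom J) {d u : G → ℕ} {l h : Sg N}
    (hl : l ∈ pc N d) (hh : h ∈ pc N d)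
    (hs : hd (insert (d, l) J) (d + u) ≤ 0) (he : hd J (d + u) = hd J u) :
    ∃ T : Module.End ℝ (pc N u ⧸ (Jp J u).comap (pc N u).subtype), ∀ v w : pc N u,
      T (Submodule.Quotient.mk v) = Submodule.Quotient.mk w →
        h * (v : Sg N) - l * w ∈ Jp J (d + u) := by
  let Q := (Jp J u).comap (pc N u).subtype
  let mm : Sg N → (pc N u →ₗ[ℝ] (Sg N ⧸ Jp J (d + u))) := fun k =>
    (Jp J (d + u)).mkQ ∘ₗ (LinearMap.mulLeft ℝ k) ∘ₗ (pc N u).subtype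
  have hker : ∀ k ∈ pc N d, Q ≤ LinearMap.ker (mm k) := by
    intro k hk x hx
    rw [LinearMap.mem_ker]
    simp only [mm, LinearMap.comp_apply]
    rw [Submodule.mkQ_apply, Submodule.Quotient.mk_eq_zero]
    exact mul_Jp hk hx
  let φ := Q.liftQ (mm l) (hker l hl)
  let ψ := Q.liftQ (mm h) (hker h hh)
  have hφ : Function.Injective φ := by
    rw [← LinearMap.ker_eq_bot, Submodule.ker_liftQ_eq_bot]
    intro x hx
    rw [LinearMap.mem_ker] at hx
    simp only [mm, LinearMap.comp_apply] at hx
    rw [Submodule.mkQ_apply, Submodule.Quotient.mk_eq_zero] at hx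
    exact inj_of hJ hl hs he x.2 hx
  have hr : ∀ x, ψ x ∈ LinearMap.range φ := by
    intro x
    obtain ⟨v, rfl⟩ := Submodule.Quotient.mk_surjective _ x
    obtain ⟨w, hw, hww⟩ := surj_of hJ hl hs (mul_pc hh v.2)
    refine ⟨Submodule.Quotient.mk ⟨w, hw⟩, ?_⟩
    simp only [φ, ψ, Submodule.liftQ_apply, mm, LinearMap.comp_apply, Submodule.mkQ_apply]
    exact ((Submodule.Quotient.eq _).mpr hww).symm
  let T := (LinearEquiv.ofInjective φ hφ).symm.toLinearMap ∘ₗ ψ.codRestrict _ hr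
  refine ⟨T, fun v w hT => ?_⟩
  have h1 : φ (T (Submodule.Quotient.mk v)) = ψ (Submodule.Quotient.mk v) := by
    have := LinearEquiv.apply_symm_apply (LinearEquiv.ofInjective φ hφ)
      (ψ.codRestrict _ hr (Submodule.Quotient.mk v))
    have := congrArg Subtype.val this
    simpa [T] using this
  rw [hT] at h1
  simp only [φ, ψ, Submodule.liftQ_apply, mm, LinearMap.comp_apply, Submodule.mkQ_apply] at h1
  exact (Submodule.Quotient.eq _).mp h1.symm

theorem core {N : G → ℕ} {J : Gens N} (hJ : Hom J) (t : G → ℕ) (l : G → Sg N)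
    (hl : ∀ g, l g ∈ pc N (un g)) (c : ℤ) (hc : Odd c) (h0 : hd J t = c)
    (h1 : ∀ i, hd J (un i + t) = c) (h2 : ∀ i j, hd J (un j + (un i + t)) = c)
    (s1 : ∀ i, hd (insert (un i, l i) J) (un i + t) ≤ 0)
    (s2 : ∀ i j, hd (insert (un j, l j) J) (un j + (un i + t)) ≤ 0) :
    ∃ p : (Σ g, Fin (N g)) → ℝ, (∀ g, ∃ a, p ⟨g, a⟩ ≠ 0) ∧
      ∀ i j f, IsBil N i j f → (un i + un j, f) ∈ J → eval p f = 0 := by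
  have inj1 : ∀ i w, w ∈ pc N t → l i * w ∈ Jp J (un i + t) → w ∈ Jp J t := fun i w hw h =>
    inj_of hJ (hl i) (s1 i) (by rw [h1, h0]) hw h
  have inj2 : ∀ i j w, w ∈ pc N t → l j * (l i * w) ∈ Jp J (un j + (un i + t)) → w ∈ Jp J t :=
    fun i j w hw h => inj1 i w hw
      (inj_of hJ (hl j) (s2 i j) (by rw [h2, h1]) (mul_pc (hl i) hw) h)
  have hop : ∀ v : (Σ g, Fin (N g)), ∃ T : Module.End ℝ (pc N t ⧸ (Jp J t).comap (pc N t).subtype),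
      ∀ x w : pc N t, T (Submodule.Quotient.mk x) = Submodule.Quotient.mk w →
        X v * (x : Sg N) - l v.1 * (w : Sg N) ∈ Jp J (un v.1 + t) := fun v =>
    exists_op hJ (hl v.1) (X_pc v.1 v.2) (s1 v.1) (by rw [h1, h0])
  choose T hT using hop
  have hcomm : ∀ v w, Commute (T v) (T w) := by
    intro v w
    apply LinearMap.ext
    intro x
    obtain ⟨x, rfl⟩ := Submodule.Quotient.mk_surjective _ x
    obtain ⟨y, hy⟩ := Submodule.Quotient.mk_surjective _ (T w (Submodule.Quotient.mk x))
    obtain ⟨z, hz⟩ := Submodule.Quotient.mk_surjective _ (T v (Submodule.Quotient.mk y))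
    obtain ⟨y', hy'⟩ := Submodule.Quotient.mk_surjective _ (T v (Submodule.Quotient.mk x))
    obtain ⟨z', hz'⟩ := Submodule.Quotient.mk_surjective _ (T w (Submodule.Quotient.mk y'))
    rw [Module.End.mul_apply, Module.End.mul_apply, ← hy, ← hz, ← hy', ← hz',
      Submodule.Quotient.eq]
    have a1 := hT _ _ _ hy.symm
    have a2 := hT _ _ _ hz.symm
    have a3 := hT _ _ _ hy'.symm
    have a4 := hT _ _ _ hz'.symm
    have b1 := mul_Jp (X_pc v.1 v.2) a1
    have b2 := mul_Jp (hl w.1) a2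
    have b3 := mul_Jp (X_pc w.1 w.2) a3
    have b4 := mul_Jp (hl v.1) a4
    rw [add_left_comm] at b1 b4
    refine inj2 v.1 w.1 _ (Submodule.sub_mem _ z.2 z'.2) ?_
    have := Submodule.sub_mem _ (Submodule.add_mem _ b3 b4) (Submodule.add_mem _ b1 b2)
    convert this using 1
    simp only [Submodule.subtype_apply, Sigma.eta, AddSubgroupClass.coe_sub]
    ring
  have hfr : (Module.finrank ℝ (pc N t ⧸ (Jp J t).comap (pc N t).subtype) : ℤ) = c := by
    have e1 := Submodule.finrank_quotient_add_finrank ((Jp J t).comap (pc N t).subtype)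
    have e2 : Module.finrank ℝ ((Jp J t).comap (pc N t).subtype) = Module.finrank ℝ (Jp J t) :=
      (Submodule.comapSubtypeEquivOfLe (Jp_le hJ t)).finrank_eq
    unfold hd at h0
    omega
  have hodd : Odd (Module.finrank ℝ (pc N t ⧸ (Jp J t).comap (pc N t).subtype)) := by
    rw [← Int.odd_coe_nat, hfr]; exact hc
  obtain ⟨v, hv, hev⟩ := common_eigen _ rfl hodd T hcomm
  obtain ⟨v, rfl⟩ := Submodule.Quotient.mk_surjective _ v
  choose p hp using hev
  have hvJ : (v : Sg N) ∉ Jp J t := by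
    intro h
    apply hv
    rw [Submodule.Quotient.mk_eq_zero]
    exact h
  have key : ∀ x : (Σ g, Fin (N g)), X x * (v : Sg N) - p x • (l x.1 * (v : Sg N)) ∈ Jp J (un x.1 + t) := by
    intro x
    have := hT x v (p x • v) (by rw [hp x]; rfl)
    simpa using this
  refine ⟨p, ?_, ?_⟩
  · intro g
    by_contra! hcon
    have hX : ∀ a, X ⟨g, a⟩ * (v : Sg N) ∈ Jp J (un g + t) := by
      intro a
      have := key ⟨g, a⟩
      rw [hcon a] at this
      simpa using this
    -- every element of degree `un g` kills `v`
    apply hvJ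
    refine inj1 g v v.2 ?_
    have hlg : ∀ d ∈ (l g).support, ∃ a, d = Finsupp.single ⟨g, a⟩ 1 := by
      intro d hd
      have hw : Finsupp.weight (wt N) d = un g := hl g (mem_support_iff.mp hd)
      obtain ⟨a, ha⟩ : ∃ a, 1 ≤ d ⟨g, a⟩ := by
        by_contra! hcon
        have := congrFun hw g
        rw [weight_apply, Finset.sum_eq_zero (fun a _ => by have := hcon a; omega)] at this
        simp at this
      refine ⟨a, ?_⟩
      have hle : Finsupp.single ⟨g, a⟩ 1 ≤ d := by rwa [Finsupp.single_le_iff]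
      have e := add_tsub_cancel_of_le hle
      have hw2 := congrArg (Finsupp.weight (wt N)) e
      rw [map_add, hw, Finsupp.weight_single] at hw2
      have hw3 : Finsupp.weight (wt N) (d - Finsupp.single ⟨g, a⟩ 1) = 0 := by
        simpa [wt] using hw2
      have hz : d - Finsupp.single ⟨g, a⟩ 1 = 0 := by
        ext ⟨g', b⟩
        have := congrFun hw3 g'
        rw [weight_apply] at this
        simp only [Pi.zero_apply, Finset.sum_eq_zero_iff] at this
        exact this b (Finset.mem_univ b)
      rw [hz, add_zero] at e
      exact e.symm
    rw [← support_sum_monomial_coeff (l g), Finset.sum_mul]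
    refine Submodule.sum_mem _ fun d hd => ?_
    obtain ⟨a, rfl⟩ := hlg d hd
    have e : monomial (Finsupp.single (⟨g, a⟩ : Σ g, Fin (N g)) 1)
        (coeff (Finsupp.single ⟨g, a⟩ 1) (l g)) = coeff (Finsupp.single ⟨g, a⟩ 1) (l g) • X ⟨g, a⟩ := by
      rw [X, smul_monomial, smul_eq_mul, mul_one]
    rw [e, smul_mul_assoc]
    exact Submodule.smul_mem _ _ (hX a)
  · intro i j f hf hfJ
    have hfv : f * (v : Sg N) ∈ Jp J (un i + un j + t) := mem_Jp hfJ v.2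
    have hdiff : f * (v : Sg N) - eval p f • (l i * (l j * (v : Sg N))) ∈ Jp J (un i + un j + t) := by
      obtain ⟨B, rfl⟩ := hf
      have : (∑ a, ∑ b, B a b • (X ⟨i, a⟩ * X ⟨j, b⟩)) * (v : Sg N) -
          eval p (∑ a, ∑ b, B a b • (X ⟨i, a⟩ * X ⟨j, b⟩)) • (l i * (l j * (v : Sg N))) =
          ∑ a, ∑ b, B a b • ((X ⟨i, a⟩ * X ⟨j, b⟩) * (v : Sg N) -
            (p ⟨i, a⟩ * p ⟨j, b⟩) • (l i * (l j * (v : Sg N)))) := by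
        simp only [map_sum, smul_eval, map_mul, eval_X, Finset.sum_mul, Finset.sum_smul,
          smul_sub, Finset.sum_sub_distrib, smul_mul_assoc, smul_smul]
      rw [this]
      refine Submodule.sum_mem _ fun a _ => Submodule.sum_mem _ fun b _ => Submodule.smul_mem _ _ ?_
      have b1 := mul_Jp (X_pc i a) (key ⟨j, b⟩)
      have b2 := mul_Jp (hl j) (key ⟨i, a⟩)
      rw [add_left_comm] at b2
      have := Submodule.add_mem _ b1 (Submodule.smul_mem _ (p ⟨j, b⟩) b2)
      rw [← add_assoc] at this
      convert this using 1
      simp only [mul_sub, smul_sub, mul_smul_comm, smul_smul]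
      rw [mul_comm (p ⟨j, b⟩) (p ⟨i, a⟩), mul_left_comm (l j) (X ⟨i, a⟩), mul_left_comm (l j) (l i),
        mul_assoc]
      abel
    by_contra hne
    have h3 : eval p f • (l i * (l j * (v : Sg N))) ∈ Jp J (un i + un j + t) := by
      have := Submodule.sub_mem _ hfv hdiff
      simpa using this
    rw [Submodule.smul_mem_iff _ hne, add_assoc] at h3
    exact hvJ (inj2 j i _ v.2 h3)

end OddBezout

namespace OddBezout

open MvPolynomial

set_option linter.unusedSectionVars false

variable {G : Type} [Fintype G] [DecidableEq G]

noncomputable def trip (N : G → ℕ) : List ((G × G) × Sg N) → Set ((G → ℕ) × Sg N × Sg N)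
  | [] => ∅
  | e :: E => insert (un e.1.1 + un e.1.2, e.2,
      lam N e.1.1 (2 * E.length) * lam N e.1.2 (2 * E.length + 1)) (trip N E)

noncomputable def pert {N : G → ℕ} (T : Set ((G → ℕ) × Sg N × Sg N)) (ε : ℝ) : Gens N :=
  (fun p => (p.1, p.2.1 + ε • p.2.2)) '' T

theorem trip_spec (N : G → ℕ) (E : List ((G × G) × Sg N)) :
    (fun p => (p.1, p.2.2)) '' trip N E = spec N (E.map Prod.fst) := by
  induction E with
  | nil => simp [trip, spec]
  | cons e E ih =>
    simp only [trip, Set.image_insert_eq, ih, List.map_cons, spec, List.length_map]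

theorem trip_bil (N : G → ℕ) (E : List ((G × G) × Sg N)) (hE : ∀ e ∈ E, IsBil N e.1.1 e.1.2 e.2) :
    ∀ p ∈ trip N E, ∃ i j, p.1 = un i + un j ∧ IsBil N i j p.2.1 ∧ IsBil N i j p.2.2 := by
  induction E with
  | nil => rintro p ⟨⟩
  | cons e E ih =>
    rintro p (rfl | hp)
    · exact ⟨e.1.1, e.1.2, rfl, hE _ (by simp), isBil_lam _ _ _ _ _⟩
    · exact ih (fun e he => hE e (by simp [he])) p hp

theorem trip_mem (N : G → ℕ) (E : List ((G × G) × Sg N)) :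
    ∀ e ∈ E, ∃ g, IsBil N e.1.1 e.1.2 g ∧ (un e.1.1 + un e.1.2, e.2, g) ∈ trip N E := by
  induction E with
  | nil => rintro p ⟨⟩
  | cons e E ih =>
    intro e' he'
    rcases List.mem_cons.mp he' with rfl | h
    · exact ⟨_, isBil_lam _ _ _ _ _, Set.mem_insert _ _⟩
    · obtain ⟨g, hg, hm⟩ := ih e' h
      exact ⟨g, hg, Set.mem_insert_of_mem _ hm⟩

theorem pert_hom (N : G → ℕ) (E : List ((G × G) × Sg N)) (hE : ∀ e ∈ E, IsBil N e.1.1 e.1.2 e.2)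
    (ε : ℝ) : Hom (pert (trip N E) ε) := by
  rintro _ ⟨p, hp, rfl⟩
  obtain ⟨i, j, h, h1, h2⟩ := trip_bil N E hE p hp
  simp only [h]
  exact (h1.add (h2.smul ε)).pc

theorem trip_pc (N : G → ℕ) (E : List ((G × G) × Sg N)) (hE : ∀ e ∈ E, IsBil N e.1.1 e.1.2 e.2) :
    ∀ p ∈ trip N E, p.2.1 ∈ pc N p.1 ∧ p.2.2 ∈ pc N p.1 := by
  intro p hp
  obtain ⟨i, j, h, h1, h2⟩ := trip_bil N E hE p hp
  rw [h]
  exact ⟨h1.pc, h2.pc⟩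

theorem cnt_empty : cnt (∅ : Finset (G × ℕ)) = 0 := by
  funext g; simp [cnt]

theorem generic_eq (N : G → ℕ) (E : List ((G × G) × Sg N)) (hE : ∀ e ∈ E, IsBil N e.1.1 e.1.2 e.2) :
    ∀ t : G → ℕ, (∀ g, 2 * E.length + 1 ≤ t g) →
      ∀ᶠ ε in Filter.cofinite, hd (pert (trip N E) ε) t = W (E.map Prod.fst) N t := by
  induction E with
  | nil =>
    intro t _
    refine Filter.Eventually.of_forall fun ε => ?_
    have h1 : pert (trip N []) ε = lin N ∅ := by simp [pert, trip, lin]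
    have h2 : Jp (lin N ∅) t = ⊥ := by
      simp [Jp, lin]
    rw [h1]
    unfold hd
    rw [h2, finrank_pc]
    simp [W]
  | cons e E ih =>
    intro t ht
    have hE' : ∀ e ∈ E, IsBil N e.1.1 e.1.2 e.2 := fun e he => hE e (by simp [he])
    have ih := ih hE'
    obtain ⟨⟨i, j⟩, f⟩ := e
    simp only [List.length_cons] at ht
    have u1 := un_le i
    have u2 := un_le j
    obtain ⟨t', rfl⟩ : ∃ t', t = un i + un j + t' := by
      refine ⟨t - (un i + un j), ?_⟩
      funext g
      have := ht g
      have := u1 g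
      have := u2 g
      simp only [Pi.add_apply, Pi.sub_apply]
      omega
    have ht' : ∀ g, 2 * E.length + 1 ≤ t' g := by
      intro g
      have := ht g
      have := u1 g
      have := u2 g
      simp only [Pi.add_apply] at *
      omega
    have hs := semicont (trip N (((i, j), f) :: E)) (fun p hp => (trip_pc N _ hE p hp).1)
      (fun p hp => (trip_pc N _ hE p hp).2) (un i + un j + t')
    rw [trip_spec] at hs
    filter_upwards [hs, ih t' ht', ih (un i + un j + t') (fun g => (ht' g).trans (by simp))] with
      ε h1 h2 h3
    apply le_antisymm
    · refine h1.trans ?_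
      have := spec_bound N (List.map Prod.fst (((i, j), f) :: E)) ∅ (un i + un j + t') (by simp)
        (fun g => by have := ht g; simp only [List.length_map, List.length_cons]; omega)
      rw [cnt_empty] at this
      simpa [lin] using this
    · have hst := W_step (E.map Prod.fst) N t' i j
        (fun g => by have := ht' g; rw [List.length_map]; omega)
      rw [List.map_cons, hst, ← h2, ← h3]
      have hp : pert (trip N (((i, j), f) :: E)) ε = insert (un i + un j,
          f + ε • (lam N i (2 * E.length) * lam N j (2 * E.length + 1))) (pert (trip N E) ε) := by
        simp [pert, trip, Set.image_insert_eq]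
      rw [hp]
      have hb : f + ε • (lam N i (2 * E.length) * lam N j (2 * E.length + 1)) ∈ pc N (un i + un j) :=
        ((hE ((i, j), f) (by simp)).add ((isBil_lam N i j _ _).smul ε)).pc
      have := exact_a (pert_hom N E hE' ε) hb (t := t')
      linarith

theorem generic_sur (N : G → ℕ) (E : List ((G × G) × Sg N)) (hE : ∀ e ∈ E, IsBil N e.1.1 e.1.2 e.2)
    (hN : ∑ g, N g = E.length + Fintype.card G) (g : G) (t : G → ℕ) (ht : ∀ g, E.length + 1 ≤ t g) :
    ∀ᶠ ε : ℝ in Filter.cofinite,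
      hd (insert (un g, ε • lam N g (2 * E.length)) (pert (trip N E) ε)) t ≤ 0 := by
  have hs := semicont (insert (un g, 0, lam N g (2 * E.length)) (trip N E))
    (by
      rintro p (rfl | hp)
      · exact Submodule.zero_mem _
      · exact (trip_pc N _ hE p hp).1)
    (by
      rintro p (rfl | hp)
      · exact lam_pc _ _ _
      · exact (trip_pc N _ hE p hp).2) t
  filter_upwards [hs] with ε h
  simp only [Set.image_insert_eq, zero_add, trip_spec] at h
  refine h.trans ?_
  have hb := spec_bound N (E.map Prod.fst) {(g, 2 * E.length)} t (by simp)
    (fun g => by have := ht g; rw [List.length_map]; omega)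
  have hlin : lin N {(g, 2 * E.length)} = {(un g, lam N g (2 * E.length))} := by simp [lin]
  rw [hlin, Set.union_singleton] at hb
  refine hb.trans ?_
  have hc : cnt {(g, 2 * E.length)} = un g := by
    have := cnt_insert (∅ : Finset (G × ℕ)) g (2 * E.length) (by simp)
    rw [cnt_empty, zero_add] at this
    exact this
  rw [hc]
  by_cases h0 : N g = 0
  · exact (W_zero _ _ _ g (by simp [h0]) (by simpa using ht)).le
  · refine (W_small _ _ _ ?_ (by simpa using ht)).le
    have := sum_sub_un N g (by omega)
    rw [List.length_map]
    omega

theorem generic_sol (N : G → ℕ) (E : List ((G × G) × Sg N)) (hE : ∀ e ∈ E, IsBil N e.1.1 e.1.2 e.2)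
    (hN : ∑ g, N g = E.length + Fintype.card G) (hodd : Odd (cf N (E.map Prod.fst))) :
    ∀ᶠ ε : ℝ in Filter.cofinite, ∃ p : (Σ g, Fin (N g)) → ℝ, (∀ g, ∃ a, p ⟨g, a⟩ ≠ 0) ∧
      ∀ q ∈ trip N E, eval p (q.2.1 + ε • q.2.2) = 0 := by
  let t : G → ℕ := fun _ => 2 * E.length + 1
  have hW : ∀ t : G → ℕ, (∀ g, 2 * E.length + 1 ≤ t g) →
      ∀ᶠ ε in Filter.cofinite, hd (pert (trip N E) ε) t = cf N (E.map Prod.fst) := by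
    intro t ht
    filter_upwards [generic_eq N E hE t ht] with ε h
    rw [h]
    exact W_eq _ _ _ (by simpa using hN) (fun g => by have := ht g; rw [List.length_map]; omega)
  have a0 := hW t (fun g => le_rfl)
  have a1 := Filter.eventually_all.mpr fun i => hW (un i + t) (fun g => by simp [t])
  have a2 := Filter.eventually_all.mpr fun i => Filter.eventually_all.mpr fun j =>
    hW (un j + (un i + t)) (fun g => by simp [t]; omega)
  have b1 := Filter.eventually_all.mpr fun i => generic_sur N E hE hN i (un i + t)
    (fun g => by simp [t]; omega)
  have b2 := Filter.eventually_all.mpr fun i => Filter.eventually_all.mpr fun j =>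
    generic_sur N E hE hN j (un j + (un i + t)) (fun g => by simp [t]; omega)
  filter_upwards [a0, a1, a2, b1, b2] with ε h0 h1 h2 s1 s2
  obtain ⟨p, hp, hq⟩ := core (pert_hom N E hE ε) t (fun g => ε • lam N g (2 * E.length))
    (fun g => Submodule.smul_mem _ _ (lam_pc _ _ _)) _ hodd h0 h1 h2 s1 s2
  refine ⟨p, hp, fun q hqm => ?_⟩
  obtain ⟨i, j, h, e1, e2⟩ := trip_bil N E hE q hqm
  refine hq i j _ (e1.add (e2.smul ε)) ?_
  exact ⟨q, hqm, by simp only [h]⟩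

end OddBezout

namespace OddBezout

open MvPolynomial

set_option linter.unusedSectionVars false

variable {G : Type} [Fintype G] [DecidableEq G]

theorem IsBil.eval_scale {N : G → ℕ} {i j : G} {f : Sg N} (h : IsBil N i j f) (c : G → ℝ)
    (p : (Σ g, Fin (N g)) → ℝ) : eval (fun x => c x.1 * p x) f = c i * c j * eval p f := by
  obtain ⟨B, rfl⟩ := h
  simp only [map_sum, smul_eval, map_mul, eval_X, Finset.mul_sum]
  refine Finset.sum_congr rfl fun a _ => Finset.sum_congr rfl fun b _ => ?_
  ring

def sph (N : G → ℕ) : Set ((Σ g, Fin (N g)) → ℝ) := {p | ∀ g, ∑ a, p ⟨g, a⟩ ^ 2 = 1}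

theorem sph_compact (N : G → ℕ) : IsCompact (sph N) := by
  refine IsCompact.of_isClosed_subset (isCompact_Icc (a := fun _ => (-1 : ℝ)) (b := fun _ => 1)) ?_ ?_
  · have : sph N = ⋂ g, {p | ∑ a, p ⟨g, a⟩ ^ 2 = 1} := by
      ext p; simp [sph]
    rw [this]
    exact isClosed_iInter fun g => isClosed_eq (by fun_prop) (by fun_prop)
  · intro p hp
    have h : ∀ x, |p x| ≤ 1 := by
      rintro ⟨g, a⟩
      rw [← sq_le_one_iff_abs_le_one, ← hp g]
      exact Finset.single_le_sum (f := fun a => p ⟨g, a⟩ ^ 2) (fun _ _ => sq_nonneg _)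
        (Finset.mem_univ a)
    exact ⟨fun x => (abs_le.mp (h x)).1, fun x => (abs_le.mp (h x)).2⟩

theorem odd_bezout (N : G → ℕ) (E : List ((G × G) × Sg N)) (hE : ∀ e ∈ E, IsBil N e.1.1 e.1.2 e.2)
    (hN : ∑ g, N g = E.length + Fintype.card G) (hodd : Odd (cf N (E.map Prod.fst))) :
    ∃ p : (Σ g, Fin (N g)) → ℝ, (∀ g, ∃ a, p ⟨g, a⟩ ≠ 0) ∧ ∀ e ∈ E, eval p e.2 = 0 := by
  have h1 : ∀ᶠ ε : ℝ in Filter.cofinite, ∃ p ∈ sph N,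
      ∀ q ∈ trip N E, eval p (q.2.1 + ε • q.2.2) = 0 := by
    filter_upwards [generic_sol N E hE hN hodd] with ε ⟨p, hp, hq⟩
    have hpos : ∀ g, 0 < ∑ a, p ⟨g, a⟩ ^ 2 := by
      intro g
      obtain ⟨a, ha⟩ := hp g
      exact Finset.sum_pos' (fun _ _ => sq_nonneg _) ⟨a, Finset.mem_univ a, by positivity⟩
    refine ⟨fun x => (Real.sqrt (∑ a, p ⟨x.1, a⟩ ^ 2))⁻¹ * p x, ?_, ?_⟩
    · intro g
      have h : ∀ S : ℝ, 0 < S → S = ∑ a, p ⟨g, a⟩ ^ 2 → ∑ a, ((Real.sqrt S)⁻¹ * p ⟨g, a⟩) ^ 2 = 1 := by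
        intro S hS hSe
        simp only [mul_pow, inv_pow]
        rw [← Finset.mul_sum, Real.sq_sqrt hS.le, ← hSe]
        exact inv_mul_cancel₀ hS.ne'
      exact h _ (hpos g) rfl
    · intro q hqm
      obtain ⟨i, j, -, e1, e2⟩ := trip_bil N E hE q hqm
      rw [(e1.add (e2.smul ε)).eval_scale (fun g => (Real.sqrt (∑ a, p ⟨g, a⟩ ^ 2))⁻¹), hq q hqm,
        mul_zero]
  have hinj : Function.Injective fun n : ℕ => (1 : ℝ) / (n + 1) := by
    intro a b h
    have := congrArg (fun x : ℝ => x⁻¹) h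
    simpa using this
  have h2 := hinj.tendsto_cofinite.eventually h1
  rw [Nat.cofinite_eq_atTop, Filter.eventually_atTop] at h2
  obtain ⟨n0, hn0⟩ := h2
  have h3 : ∀ n : ℕ, ∃ p ∈ sph N,
      ∀ q ∈ trip N E, eval p (q.2.1 + ((1 : ℝ) / ((n + n0 : ℕ) + 1)) • q.2.2) = 0 := fun n =>
    hn0 (n + n0) (by omega)
  choose p hp hpq using h3
  obtain ⟨p0, hp0, φ, hφ, hlim⟩ := (sph_compact N).tendsto_subseq hp
  refine ⟨p0, ?_, ?_⟩
  · intro g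
    by_contra! hcon
    have := hp0 g
    simp [hcon] at this
  · intro e he
    obtain ⟨f, -, hm⟩ := trip_mem N E e he
    have hε : Filter.Tendsto (fun n => (1 : ℝ) / ((φ n + n0 : ℕ) + 1)) Filter.atTop (nhds 0) := by
      have h := tendsto_one_div_add_atTop_nhds_zero_nat (𝕜 := ℝ)
      exact h.comp ((Filter.tendsto_add_atTop_nat n0).comp hφ.tendsto_atTop)
    have hc : ∀ f : Sg N, Filter.Tendsto (fun n => eval (p (φ n)) f) Filter.atTop
        (nhds (eval p0 f)) := fun f => ((continuous_eval f).tendsto p0).comp hlim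
    have hl := (hc e.2).add (hε.mul (hc f))
    have hz : ∀ n, eval (p (φ n)) e.2 + (1 : ℝ) / ((φ n + n0 : ℕ) + 1) * eval (p (φ n)) f = 0 := by
      intro n
      have := hpq (φ n) _ hm
      simpa [smul_eval] using this
    simp only [hz, zero_mul, add_zero] at hl
    exact tendsto_nhds_unique hl tendsto_const_nhds

end OddBezout

namespace OddBezout

open MvPolynomial

theorem factor_eq {s : ℕ} (i : Fin s) (j M : ℕ) :
    (X (some i) ^ j * (X none + X (some i)) ^ M : MvPolynomial (Option (Fin s)) ℤ) =
      ∑ k ∈ Finset.range (M + 1),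
        monomial (Finsupp.single (some i) (j + k) + Finsupp.single none (M - k)) (M.choose k : ℤ) := by
  rw [add_comm (X none), add_pow, Finset.mul_sum]
  refine Finset.sum_congr rfl fun k _ => ?_
  have h : monomial (Finsupp.single (some i) (j + k) + Finsupp.single none (M - k)) (M.choose k : ℤ)
      = C (M.choose k : ℤ) * (X (some i) ^ (j + k) * X none ^ (M - k)) := by
    rw [X_pow_eq_monomial, X_pow_eq_monomial, monomial_mul, C_mul_monomial]
    simp
  rw [h, pow_add]
  simp only [map_natCast]
  ring

theorem prod_monomial {ι σ : Type} (S : Finset ι) (a : ι → σ →₀ ℕ) (c : ι → ℤ) :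
    ∏ i ∈ S, monomial (a i) (c i) = monomial (∑ i ∈ S, a i) (∏ i ∈ S, c i) := by
  classical
  induction S using Finset.induction_on with
  | empty => simp
  | insert x S hx ih => rw [Finset.prod_insert hx, Finset.sum_insert hx, Finset.prod_insert hx, ih,
      monomial_mul]

theorem coeff_term {s : ℕ} (j M : Fin s → ℕ) (e : Option (Fin s) →₀ ℕ)
    (he : e none + ∑ i, e (some i) = ∑ i, (M i + j i)) :
    coeff e (∏ i, (X (some i) ^ j i * (X none + X (some i)) ^ M i) : MvPolynomial (Option (Fin s)) ℤ)
      = ∏ i, if j i ≤ e (some i) then ((M i).choose (e (some i) - j i) : ℤ) else 0 := by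
  classical
  have h1 : ∀ i, (if j i ≤ e (some i) then ((M i).choose (e (some i) - j i) : ℤ) else 0) =
      ∑ k ∈ Finset.range (M i + 1), if j i + k = e (some i) then ((M i).choose k : ℤ) else 0 := by
    intro i
    split_ifs with h
    · by_cases hM : e (some i) - j i ∈ Finset.range (M i + 1)
      · rw [Finset.sum_eq_single_of_mem _ hM]
        · rw [if_pos (by omega)]
        · intro k _ hk
          rw [if_neg (by omega)]
      · rw [Finset.sum_eq_zero]
        · rw [Nat.choose_eq_zero_of_lt]
          · simp
          · simp at hM; omega
        · intro k hk
          rw [if_neg]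
          rintro h'
          apply hM
          have : e (some i) - j i = k := by omega
          rwa [this]
    · rw [Finset.sum_eq_zero]
      intro k _
      rw [if_neg (by omega)]
  simp only [h1, factor_eq]
  rw [Finset.prod_univ_sum, Finset.prod_univ_sum, coeff_sum]
  refine Finset.sum_congr rfl fun κ hκ => ?_
  rw [Fintype.mem_piFinset] at hκ
  simp only [Finset.mem_range] at hκ
  rw [prod_monomial, coeff_monomial, Finset.prod_ite_zero]
  have e1 : ∀ i, (∑ x, (Finsupp.single (some x) (j x + κ x) +
      (Finsupp.single none (M x - κ x) : Option (Fin s) →₀ ℕ))) (some i) = j i + κ i := by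
    intro i
    rw [Finsupp.finsetSum_apply, Finset.sum_eq_single i]
    · simp
    · intro b _ hb
      simp [hb]
    · simp
  have e2 : (∑ x, (Finsupp.single (some x) (j x + κ x) +
      (Finsupp.single none (M x - κ x) : Option (Fin s) →₀ ℕ))) none = ∑ x, (M x - κ x) := by
    rw [Finsupp.finsetSum_apply]
    simp
  have key : (∑ x, (Finsupp.single (some x) (j x + κ x) +
      (Finsupp.single none (M x - κ x) : Option (Fin s) →₀ ℕ))) = e ↔
      ∀ i ∈ Finset.univ, j i + κ i = e (some i) := by
   constructor
   · rintro h i _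
     rw [← e1 i, h]
   · intro h
     ext o
     cases o with
     | some i => rw [e1, h i (Finset.mem_univ i)]
     | none =>
       rw [e2]
       have h2 : ∑ i, e (some i) = ∑ i, (j i + κ i) :=
         Finset.sum_congr rfl fun i _ => (h i (Finset.mem_univ i)).symm
       have h3 : ∑ x, (M x - κ x) + ∑ i, (j i + κ i) = ∑ i, (M i + j i) := by
         rw [← Finset.sum_add_distrib]
         refine Finset.sum_congr rfl fun i _ => ?_
         have := hκ i
         omega
       omega
  by_cases hk : ∀ i ∈ Finset.univ, j i + κ i = e (some i)
  · rw [if_pos (key.mpr hk), if_pos hk]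
  · rw [if_neg (fun h => hk (key.mp h)), if_neg hk]

/-- The determinant of binomial coefficients. -/
theorem det_binom (m r s : ℕ) (h : r + s ≤ m) :
    ((Matrix.of fun i j : Fin s => (if (j : ℕ) ≤ r + i then
        (((m + (s - 1 - j)).choose (r + i - j) : ℕ) : ℚ) else 0)).det : ℚ) =
      ∏ i ∈ Finset.range s, (((m + i).factorial * i.factorial : ℚ) /
        ((r + i).factorial * (m - r + i).factorial : ℚ)) := by
  rcases s with _ | s
  · simp
  have hB : (Matrix.of fun i j : Fin (s + 1) => (if (j : ℕ) ≤ r + i then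
        (((m + (s + 1 - 1 - j)).choose (r + i - j) : ℕ) : ℚ) else 0)) =
      Matrix.of fun i j : Fin (s + 1) => (((m - r + (s - i)).factorial * (r + i).factorial : ℚ))⁻¹ *
        (Matrix.of fun i j : Fin (s + 1) => ((m + (s - j)).factorial : ℚ) *
          (Matrix.of fun i j : Fin (s + 1) => (((r + i : ℕ).descFactorial j : ℕ) : ℚ)) i j) i j := by
    ext i j
    simp only [Matrix.of_apply]
    have hi := i.2
    have hj := j.2
    split_ifs with hle
    · have h1 : (r + i).descFactorial j * (r + i - j).factorial = (r + i).factorial := by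
        rw [mul_comm]; exact Nat.factorial_mul_descFactorial hle
      have h2 := Nat.choose_mul_factorial_mul_factorial (n := m + (s - j)) (k := r + i - j) (by omega)
      have h3 : m + (s - j) - (r + i - j) = m - r + (s - i) := by omega
      rw [h3] at h2
      have e1 : m + (s + 1 - 1 - j) = m + (s - j) := by omega
      rw [e1, ← h2, ← h1]
      push_cast
      have p1 : ((r + i - j).factorial : ℚ) ≠ 0 := by positivity
      have p2 : ((m - r + (s - i)).factorial : ℚ) ≠ 0 := by positivity
      have p3 : ((r + i).descFactorial j : ℚ) ≠ 0 := by
        have : (r + i).descFactorial j ≠ 0 := by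
          rw [Ne, Nat.descFactorial_eq_zero_iff_lt]; omega
        exact_mod_cast this
      field_simp
    · have : (r + i).descFactorial j = 0 := by
        rw [Nat.descFactorial_eq_zero_iff_lt]; omega
      rw [this]; simp
  rw [hB, Matrix.det_mul_column, Matrix.det_mul_row]
  have hV : (Matrix.of fun i j : Fin (s + 1) => (((r + i : ℕ).descFactorial j : ℕ) : ℚ)).det =
      ∏ i ∈ Finset.range (s + 1), (i.factorial : ℚ) := by
    have h1 := Matrix.det_eval_matrixOfPolynomials_eq_det_vandermonde
      (fun i : Fin (s + 1) => ((i : ℕ) : ℚ) + (r : ℚ)) (fun i => descPochhammer ℚ i)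
      (fun i => descPochhammer_natDegree ℚ i) (fun i => monic_descPochhammer ℚ i)
    rw [Matrix.det_vandermonde_add, Matrix.det_vandermonde_id_eq_superFactorial] at h1
    have h2 : (Matrix.of fun i j : Fin (s + 1) =>
        (descPochhammer ℚ j).eval (((i : ℕ) : ℚ) + (r : ℚ))) =
        (Matrix.of fun i j : Fin (s + 1) => (((r + i : ℕ).descFactorial j : ℕ) : ℚ)) := by
      ext i j
      simp only [Matrix.of_apply]
      rw [← descPochhammer_eval_eq_descFactorial]
      push_cast
      rw [add_comm]
    rw [h2] at h1
    rw [← h1, ← Nat.prod_range_factorial_succ, Finset.prod_range_succ' _ s]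
    push_cast
    simp
  rw [hV]
  rw [Finset.prod_div_distrib, Finset.prod_mul_distrib, Finset.prod_mul_distrib]
  rw [Fin.prod_univ_eq_prod_range (fun i => (((m - r + (s - i)).factorial * (r + i).factorial : ℚ))⁻¹) (s + 1),
    Fin.prod_univ_eq_prod_range (fun j => ((m + (s - j)).factorial : ℚ)) (s + 1)]
  rw [Finset.prod_inv_distrib, Finset.prod_mul_distrib]
  have r1 := Finset.prod_range_reflect (fun i => ((m + i).factorial : ℚ)) (s + 1)
  have r2 := Finset.prod_range_reflect (fun i => ((m - r + i).factorial : ℚ)) (s + 1)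
  simp only [Nat.add_sub_cancel] at r1 r2
  rw [r1, r2]
  field_simp

end OddBezout

namespace OddBezout

open MvPolynomial

def Nf (m r s : ℕ) : Option (Fin s) → ℕ := fun o => o.elim ((m - r) * s + 1) (fun i => r + 1 + i)

theorem det_poly (m s : ℕ) :
    ((∏ i : Fin s, (X none + X (some i)) ^ m) * ∏ i : Fin s, ∏ j ∈ Finset.Ioi i,
      (X (some j) - X (some i)) : MvPolynomial (Option (Fin s)) ℤ) *
        X none ^ (∑ i : Fin s, (s - 1 - (i : ℕ))) =
    (Matrix.of fun i j : Fin s => (X (some i) ^ (j : ℕ) *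
      (X none + X (some i)) ^ (m + (s - 1 - j)) : MvPolynomial (Option (Fin s)) ℤ)).det := by
  have h1 := Matrix.det_projVandermonde (fun i : Fin s => (X (some i) : MvPolynomial (Option (Fin s)) ℤ))
    (fun i => X none + X (some i))
  have h2 : ∀ i j : Fin s, (X (some j) * (X none + X (some i)) - X (some i) * (X none + X (some j)) :
      MvPolynomial (Option (Fin s)) ℤ) = X none * (X (some j) - X (some i)) := fun i j => by ring
  simp only [h2, Finset.prod_mul_distrib, Finset.prod_const, Fin.card_Ioi] at h1
  rw [Finset.prod_pow_eq_pow_sum] at h1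
  rw [mul_assoc, mul_comm (∏ i, ∏ j ∈ Finset.Ioi i, _), ← h1, ← Matrix.det_mul_column]
  congr 1
  ext1 i j
  simp only [Matrix.of_apply, Matrix.projVandermonde_apply, Fin.val_rev]
  have : s - (j + 1) = s - 1 - j := by omega
  rw [this, pow_add]
  ring

theorem coeff_det (m r s : ℕ) (h : r + s ≤ m) (e : Option (Fin s) →₀ ℕ)
    (h0 : e none = (m - r) * s) (h1 : ∀ i, e (some i) = r + i) :
    ((coeff e ((∏ i : Fin s, (X none + X (some i)) ^ m) * ∏ i : Fin s, ∏ j ∈ Finset.Ioi i,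
      (X (some j) - X (some i)) : MvPolynomial (Option (Fin s)) ℤ) : ℤ) : ℚ) =
      ∏ i ∈ Finset.range s, (((m + i).factorial * i.factorial : ℚ) /
        ((r + i).factorial * (m - r + i).factorial : ℚ)) := by
  rw [← det_binom m r s h]
  rw [← mul_one (coeff e _), ← coeff_mul_monomial e (Finsupp.single none (∑ i : Fin s, (s - 1 - (i : ℕ)))) 1,
    ← X_pow_eq_monomial, det_poly, ← Matrix.det_transpose, Matrix.det_apply, coeff_sum,
    ← Matrix.det_transpose, Matrix.det_apply]
  push_cast
  refine Finset.sum_congr rfl fun σ _ => ?_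
  rw [coeff_smul]
  simp only [Matrix.transpose_apply, Matrix.of_apply]
  rw [coeff_term (fun i => (σ i : ℕ)) (fun i => m + (s - 1 - (σ i : ℕ)))]
  · simp [h1, Units.smul_def]
  · simp only [Finsupp.add_apply, Finsupp.single_eq_same, h0, h1]
    have e1 : ∀ i : Fin s, (Finsupp.single (none : Option (Fin s))
      (∑ i : Fin s, (s - 1 - (i : ℕ)))) (some i) = 0 := fun i => by simp
    simp only [e1, add_zero]
    rw [add_assoc, ← Finset.sum_add_distrib]
    have e2 : ∀ i : Fin s, s - 1 - (i : ℕ) + (r + i) = r + (s - 1) := fun i => by omega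
    have e3 : ∀ i : Fin s, m + (s - 1 - (σ i : ℕ)) + σ i = m + (s - 1) := fun i => by omega
    simp only [e2, e3, Finset.sum_const, Finset.card_univ, Fintype.card_fin, smul_eq_mul]
    obtain ⟨k, rfl⟩ := Nat.exists_eq_add_of_le h
    have : r + s + k - r = s + k := by omega
    rw [this]
    ring

theorem cf_odd (m r s : ℕ) (h : r + s ≤ m) (D : ℤ) (hD : Odd D)
    (hD' : (D : ℚ) = ∏ i ∈ Finset.range s, (((m + i).factorial * i.factorial : ℚ) /
        ((r + i).factorial * (m - r + i).factorial : ℚ)))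
    (L : List (Option (Fin s) × Option (Fin s)))
    (hL : (L.map fun p => X p.1 + X p.2).prod =
      ((∏ i : Fin s, (X none + X (some i)) ^ m) * ∏ i : Fin s, ∏ j ∈ Finset.Ioi i,
      (X (some j) + X (some i)) : MvPolynomial (Option (Fin s)) ℤ)) : Odd (cf (Nf m r s) L) := by
  let e : Option (Fin s) →₀ ℕ := Finsupp.equivFunOnFinite.symm
    (fun o => o.elim ((m - r) * s) (fun i => r + i))
  have he : Finsupp.equivFunOnFinite.symm (Nf m r s) = e + Finsupp.equivFunOnFinite.symm 1 := by
    ext o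
    cases o with
    | none => simp [e, Nf]
    | some i => simp [e, Nf]; omega
  have h1 := coeff_det m r s h e rfl (fun i => rfl)
  rw [← hD'] at h1
  have h2 := Int.cast_injective h1
  have h3 : cf (Nf m r s) L = coeff e ((∏ i : Fin s, (X none + X (some i)) ^ m) *
      ∏ i : Fin s, ∏ j ∈ Finset.Ioi i, (X (some j) + X (some i))) := by
    unfold cf genP
    rw [he, prod_X_eq, coeff_mul_monomial, mul_one, hL]
  rw [← ZMod.intCast_eq_one_iff_odd] at hD ⊢
  rw [← hD, h3, ← h2]
  have h4 : ∀ P : MvPolynomial (Option (Fin s)) ℤ, ((coeff e P : ℤ) : ZMod 2) =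
      coeff e (map (Int.castRingHom (ZMod 2)) P) := fun P => by rw [coeff_map]; rfl
  rw [h4, h4]
  congr 1
  simp only [map_mul, map_prod, map_pow, map_add, map_sub, map_X]
  congr 1
  refine Finset.prod_congr rfl fun i _ => Finset.prod_congr rfl fun j _ => ?_
  rw [CharTwo.sub_eq_add]

end OddBezout

namespace OddBezout

open MvPolynomial

/-- Extension by zero of a vector. -/
def ext0 {q : ℕ} (n : ℕ) (x : Fin q → ℝ) : Fin n → ℝ := fun c => ∑ l : Fin q, if (c : ℕ) = l then x l else 0

theorem sum_ext0 {q n : ℕ} (h : q ≤ n) (x : Fin q → ℝ) (f : Fin n → ℝ) :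
    ∑ c, f c * ext0 n x c = ∑ l, f (Fin.castLE h l) * x l := by
  simp only [ext0, Finset.mul_sum]
  rw [Finset.sum_comm]
  refine Finset.sum_congr rfl fun l _ => ?_
  rw [Finset.sum_eq_single (Fin.castLE h l)]
  · simp
  · intro c _ hc
    rw [if_neg, mul_zero]
    intro h'
    exact hc (Fin.ext h')
  · simp

theorem ext0_castLE {q n : ℕ} (h : q ≤ n) (x : Fin q → ℝ) (l : Fin q) :
    ext0 n x (Fin.castLE h l) = x l := by
  simp only [ext0, Fin.val_castLE]
  rw [Finset.sum_eq_single l]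
  · simp
  · intro c _ hc
    rw [if_neg]
    intro h'
    exact hc (Fin.ext h'.symm)
  · simp

/-- Orthogonal kernel vectors bound the rank. -/
theorem rank_le {m n s : ℕ} (M : Matrix (Fin m) (Fin n) ℝ) (v : Fin s → Fin n → ℝ)
    (hv : ∀ i, v i ≠ 0) (ho : ∀ i j, i < j → v i ⬝ᵥ v j = 0) (hk : ∀ i, M.mulVec (v i) = 0) :
    M.rank + s ≤ n := by
  have ho' : ∀ i j, i ≠ j → v i ⬝ᵥ v j = 0 := by
    intro i j hij
    rcases lt_or_gt_of_ne hij with h | h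
    · exact ho i j h
    · rw [dotProduct_comm]; exact ho j i h
  have hli : LinearIndependent ℝ v := by
    rw [Fintype.linearIndependent_iff]
    intro g hg i
    have h1 : (∑ j, g j • v j) ⬝ᵥ v i = 0 := by rw [hg, zero_dotProduct]
    rw [sum_dotProduct, Finset.sum_eq_single i] at h1
    · rw [smul_dotProduct, smul_eq_mul, mul_eq_zero, dotProduct_self_eq_zero] at h1
      exact h1.resolve_right (hv i)
    · intro j _ hj
      rw [smul_dotProduct, ho' j i hj, smul_zero]
    · simp
  have hspan : Submodule.span ℝ (Set.range v) ≤ LinearMap.ker M.mulVecLin := by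
    rw [Submodule.span_le]
    rintro _ ⟨i, rfl⟩
    exact hk i
  have h2 := Submodule.finrank_mono hspan
  rw [finrank_span_eq_card hli, Fintype.card_fin] at h2
  have h3 := LinearMap.finrank_range_add_finrank_ker M.mulVecLin
  rw [Module.finrank_fin_fun] at h3
  unfold Matrix.rank
  omega

theorem main_app (m n r s : ℕ) (hns : r + s = n) (hnm : n ≤ m) (D : ℤ) (hD : Odd D)
    (hD' : (D : ℚ) = ∏ i ∈ Finset.range s, (((m + i).factorial * i.factorial : ℚ) /
        ((r + i).factorial * (m - r + i).factorial : ℚ)))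
    (C : Submodule ℝ (Matrix (Fin m) (Fin n) ℝ))
    (hC : ∀ A ∈ C, A ≠ 0 → r + 1 ≤ A.rank) : Module.finrank ℝ C ≤ (m - r) * s := by
  classical
  by_contra! hlt
  obtain ⟨c, hc⟩ := exists_linearIndependent_of_le_finrank (R := ℝ) (M := C) (n := (m - r) * s + 1) hlt
  let N := Nf m r s
  have hle : ∀ i : Fin s, N (some i) ≤ n := fun i => by
    have := i.2
    change r + 1 + (i : ℕ) ≤ n
    omega
  let A : Fin (N none) → Matrix (Fin m) (Fin n) ℝ := fun b => (c b).1
  let F : Fin s → Fin m → Sg N := fun i a => ∑ b : Fin (N none), ∑ l : Fin (N (some i)),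
    (A b a (Fin.castLE (hle i) l)) • (X ⟨none, b⟩ * X ⟨some i, l⟩)
  let H : Fin s → Fin s → Sg N := fun i j => ∑ l' : Fin (N (some j)), ∑ l : Fin (N (some i)),
    (if (l : ℕ) = l' then (1 : ℝ) else 0) • (X ⟨some j, l'⟩ * X ⟨some i, l⟩)
  let E1 : List ((Option (Fin s) × Option (Fin s)) × Sg N) :=
    (Finset.univ : Finset (Fin s × Fin m)).toList.map fun q => ((none, some q.1), F q.1 q.2)
  let E2 : List ((Option (Fin s) × Option (Fin s)) × Sg N) :=
    ((Finset.univ : Finset (Fin s)).sigma fun i => Finset.Ioi i).toList.map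
      fun q => ((some q.2, some q.1), H q.1 q.2)
  have hbil : ∀ e ∈ E1 ++ E2, IsBil N e.1.1 e.1.2 e.2 := by
    intro e he
    rcases List.mem_append.mp he with h | h
    · obtain ⟨q, -, rfl⟩ := List.mem_map.mp h
      exact ⟨_, rfl⟩
    · obtain ⟨q, -, rfl⟩ := List.mem_map.mp h
      exact ⟨_, rfl⟩
  have hsum : ∑ g, N g = (E1 ++ E2).length + Fintype.card (Option (Fin s)) := by
    have h1 : ∑ i : Fin s, (s - 1 - (i : ℕ)) = ∑ i : Fin s, (i : ℕ) := by
      rw [Fin.sum_univ_eq_sum_range (fun i => s - 1 - i), Fin.sum_univ_eq_sum_range (fun i => i)]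
      exact Finset.sum_range_reflect (fun i => i) s
    simp only [E1, E2, List.length_append, List.length_map, Finset.length_toList, Finset.card_sigma,
      Fin.card_Ioi, Finset.card_univ, Fintype.card_prod, Fintype.card_fin, Fintype.card_option, h1,
      Fintype.sum_option, N, Nf, Option.elim, Finset.sum_add_distrib, Finset.sum_const, smul_eq_mul]
    obtain ⟨k, rfl⟩ := Nat.exists_eq_add_of_le hnm
    subst hns
    have : r + s + k - r = s + k := by omega
    rw [this]
    ring
  have hodd : Odd (cf N ((E1 ++ E2).map Prod.fst)) := by
    refine cf_odd m r s (by omega) D hD hD' _ ?_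
    simp only [E1, E2, List.map_append, List.map_map, List.prod_append]
    congr 1
    · rw [Finset.prod_map_toList, Fintype.prod_prod_type]
      simp
    · rw [Finset.prod_map_toList, Finset.prod_sigma]
      rfl
  obtain ⟨p, hp, hpE⟩ := odd_bezout N (E1 ++ E2) hbil hsum hodd
  let M : C := ∑ b : Fin (N none), p ⟨none, b⟩ • c b
  have hM : M ≠ 0 := by
    intro h0
    obtain ⟨b, hb⟩ := hp none
    exact hb (Fintype.linearIndependent_iff.mp hc _ h0 b)
  let v : Fin s → Fin n → ℝ := fun i => ext0 n (q := N (some i)) fun l => p ⟨some i, l⟩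
  let M' : Matrix (Fin m) (Fin n) ℝ := ∑ b : Fin (N none), p ⟨none, b⟩ • A b
  have hMM : (M : Matrix (Fin m) (Fin n) ℝ) = M' := by
    simp only [M, M', A, Submodule.coe_sum, Submodule.coe_smul]
  have hrank := rank_le M' v ?_ ?_ ?_
  · have := hC M M.2 (by simpa using hM)
    rw [hMM] at this
    omega
  · intro i h0
    obtain ⟨l, hl⟩ := hp (some i)
    apply hl
    have := congrFun h0 (Fin.castLE (hle i) l)
    simp only [v] at this
    rw [ext0_castLE] at this
    exact this
  · intro i j hij
    have h1 : eval p (H i j) = 0 := hpE ((some j, some i), H i j) (by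
      refine List.mem_append_right _ (List.mem_map.mpr ⟨⟨i, j⟩, ?_, rfl⟩)
      simp [hij])
    rw [dotProduct_comm, dotProduct, ← h1]
    simp only [v, H, map_sum, smul_eval, map_mul, eval_X]
    rw [sum_ext0 (q := N (some i)) (hle i), Finset.sum_comm]
    refine Finset.sum_congr rfl fun l _ => ?_
    rw [ext0, Finset.sum_mul]
    refine Finset.sum_congr rfl fun l' _ => ?_
    rw [Fin.val_castLE]
    split_ifs <;> simp
  · intro i
    funext a
    have h1 : eval p (F i a) = 0 := hpE ((none, some i), F i a) (by
      refine List.mem_append_left _ (List.mem_map.mpr ⟨⟨i, a⟩, ?_, rfl⟩)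
      simp)
    rw [Matrix.mulVec, dotProduct, Pi.zero_apply, ← h1]
    simp only [v, F, map_sum, smul_eval, map_mul, eval_X]
    rw [sum_ext0 (q := N (some i)) (hle i), Finset.sum_comm]
    refine Finset.sum_congr rfl fun l _ => ?_
    have h2 : M' a (Fin.castLE (hle i) l) =
        ∑ b : Fin (N none), p ⟨none, b⟩ * A b a (Fin.castLE (hle i) l) := by
      simp only [M', Matrix.sum_apply, Matrix.smul_apply, smul_eq_mul]
    rw [h2, Finset.sum_mul]
    refine Finset.sum_congr rfl fun b _ => ?_
    ring

end OddBezout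

/-- if the degree `d(n,m,d-1)` of the determinantal variety,
`D = Π_{i=0}^{n−d} ((m+i)!·i!)/((d−1+i)!·(m−d+1+i)!)`, is an odd integer, then
any subspace of `m×n` real matrices whose nonzero elements all have rank at
least `d` has dimension at most `(m−d+1)(n−d+1)`. -/
theorem odd_degree_bound_over_reals (m n d : ℕ) (hd : 0 < d) (hdn : d < n) (hnm : n ≤ m)
    (hD : ∃ D : ℤ, Odd D ∧ (D : ℚ) =
      ∏ i ∈ Finset.range (n - d + 1),
        ((Nat.factorial (m + i) * Nat.factorial i : ℚ) /
          (Nat.factorial (d - 1 + i) * Nat.factorial (m - d + 1 + i) : ℚ)))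
    (C : Submodule ℝ (Matrix (Fin m) (Fin n) ℝ))
    (hC : ∀ A ∈ C, A ≠ 0 → d ≤ A.rank) :
    Module.finrank ℝ C ≤ (m - d + 1) * (n - d + 1) := by
  obtain ⟨D, hodd, hD'⟩ := hD
  have e1 : n - d + 1 = n - (d - 1) := by omega
  have e2 : m - d + 1 = m - (d - 1) := by omega
  simp only [e1, e2] at hD' ⊢
  exact OddBezout.main_app m n (d - 1) (n - (d - 1)) (by omega) hnm D hodd hD' C
    (fun A hA h0 => by have := hC A hA h0; omega)
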